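/- arXiv:1512.05321 — 9 statements merged into one kernel-verified Lean document; each statement's English description precedes it below -/
import Mathlib

section
/- Fix γ > 0 and let ν be the measure on (0, 1/2) with density y ↦ 1/(y² (log(1/y))^γ) with respect to Lebesgue measure. Then: (a) the function J₂′(z) := ∫_{(0,1/2)} y(1 − e^{−zy}) ν(dy) = ∫_0^{1/2} (1 − e^{−zy})/(y (log(1/y))^γ) dy satisfies lim_{z→∞} J₂′(z)/log z = 0, and consequently lim_{z→∞} (log z − a·J₂′(z)) = +∞ for every a > 0; (b) ∫_{(0,1/2)} y ν(dy) < ∞ if and only if γ > 1. -/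
open MeasureTheory Set Filter

lemma one_sub_exp_neg_le {t : ℝ} (ht : 0 ≤ t) : 1 - Real.exp (-t) ≤ 2 * t / (1 + t) := by
  rw [le_div_iff₀ (by positivity)]
  have h₁ : 1 - t ≤ Real.exp (-t) := Real.one_sub_le_exp_neg t
  have h₂ := Real.exp_pos (-t)
  rcases le_total t 1 with h | h <;> nlinarith

lemma log_two_lt_log_one_div {y : ℝ} (hy : y ∈ Ioo (0 : ℝ) (1 / 2)) :
    Real.log 2 < Real.log (1 / y) := by
  apply Real.log_lt_log two_pos
  rw [lt_div_iff₀ hy.1]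
  linarith [hy.2]

lemma log_one_div_pos {y : ℝ} (hy : y ∈ Ioo (0 : ℝ) (1 / 2)) : 0 < Real.log (1 / y) :=
  (Real.log_pos one_lt_two).trans (log_two_lt_log_one_div hy)

/-- The weight `(log (1 / y)) ^ (-γ)` is small near `0`, up to a linear term. -/
lemma exists_inv_log_rpow_le {γ : ℝ} (hγ : 0 < γ) {ε : ℝ} (hε : 0 < ε) :
    ∃ D : ℝ, 0 ≤ D ∧ ∀ y ∈ Ioo (0 : ℝ) (1 / 2), (Real.log (1 / y) ^ γ)⁻¹ ≤ ε + D * y := by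
  have hlim : Tendsto (fun y : ℝ => (Real.log (1 / y) ^ γ)⁻¹) (nhdsWithin 0 (Ioi 0)) (nhds 0) := by
    simp only [one_div]
    exact ((tendsto_rpow_atTop hγ).comp
      (Real.tendsto_log_atTop.comp tendsto_inv_nhdsGT_zero)).inv_tendsto_atTop
  obtain ⟨δ, hδ, hδε⟩ :=
    mem_nhdsGT_iff_exists_Ioo_subset.1 (hlim.eventually (gt_mem_nhds hε))
  have hδ : 0 < δ := hδ
  have hc : 0 < Real.log 2 ^ γ := Real.rpow_pos_of_pos (Real.log_pos one_lt_two) γ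
  refine ⟨(Real.log 2 ^ γ)⁻¹ / δ, by positivity, fun y hy => ?_⟩
  have hy₀ := hy.1
  rcases lt_or_ge y δ with h | h
  · have : (Real.log (1 / y) ^ γ)⁻¹ < ε := hδε ⟨hy₀, h⟩
    have : 0 ≤ (Real.log 2 ^ γ)⁻¹ / δ * y := by positivity
    linarith
  · have h₁ : (Real.log (1 / y) ^ γ)⁻¹ ≤ (Real.log 2 ^ γ)⁻¹ := by
      have hlog := Real.rpow_le_rpow (Real.log_nonneg one_le_two)
        (log_two_lt_log_one_div hy).le hγ.le
      gcongr
    have h₂ : (Real.log 2 ^ γ)⁻¹ ≤ (Real.log 2 ^ γ)⁻¹ / δ * y := by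
      rw [div_mul_eq_mul_div, le_div_iff₀ hδ]
      gcongr
    linarith

lemma integral_div_one_add_mul {z : ℝ} (hz : 0 < z) :
    IntegrableOn (fun y => z / (1 + z * y)) (Ioo (0 : ℝ) (1 / 2)) ∧
      ∫ y in Ioo (0 : ℝ) (1 / 2), z / (1 + z * y) = Real.log (1 + z / 2) := by
  have hpos : ∀ y ∈ uIcc (0 : ℝ) (1 / 2), 0 < 1 + z * y := by
    intro y hy
    rw [uIcc_of_le (by norm_num)] at hy
    nlinarith [hy.1]
  have hint : IntervalIntegrable (fun y => z / (1 + z * y)) volume 0 (1 / 2) :=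
    ContinuousOn.intervalIntegrable
      (continuousOn_const.div (by fun_prop) fun y hy => (hpos y hy).ne')
  refine ⟨((intervalIntegrable_iff_integrableOn_Ioo_of_le (by norm_num)).1 hint), ?_⟩
  rw [← integral_Ioc_eq_integral_Ioo, ← intervalIntegral.integral_of_le (by norm_num),
    intervalIntegral.integral_eq_sub_of_hasDerivAt
      (f := fun y => Real.log (1 + z * y)) (fun y hy => ?_) hint]
  · simp [div_eq_mul_inv]
  · have := (((hasDerivAt_id y).const_mul z).const_add 1).log (hpos y hy).ne'
    simpa using this

lemma integral_one_sub_exp_nonneg (γ : ℝ) {z : ℝ} (hz : 0 ≤ z) :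
    0 ≤ ∫ y in Ioo (0 : ℝ) (1 / 2), (1 - Real.exp (-z * y)) / (y * Real.log (1 / y) ^ γ) := by
  refine setIntegral_nonneg measurableSet_Ioo fun y hy => div_nonneg ?_ ?_
  · have : -z * y ≤ 0 := by nlinarith [hy.1]
    linarith [Real.exp_le_one_iff.2 this]
  · exact mul_nonneg hy.1.le (Real.rpow_nonneg (log_one_div_pos hy).le γ)

lemma exists_integral_one_sub_exp_le {γ : ℝ} (hγ : 0 < γ) {ε : ℝ} (hε : 0 < ε) :
    ∃ C : ℝ, ∀ z : ℝ, 2 ≤ z →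
      ∫ y in Ioo (0 : ℝ) (1 / 2), (1 - Real.exp (-z * y)) / (y * Real.log (1 / y) ^ γ)
        ≤ ε * Real.log z + C := by
  obtain ⟨D, hD, hle⟩ := exists_inv_log_rpow_le hγ (half_pos hε)
  refine ⟨D * (1 / 2), fun z hz => ?_⟩
  have hz₀ : 0 < z := by linarith
  obtain ⟨hint, heq⟩ := integral_div_one_add_mul hz₀
  have hintD : IntegrableOn (fun _ => D) (Ioo (0 : ℝ) (1 / 2)) :=
    integrableOn_const (by simp)
  calc
    _ ≤ ∫ y in Ioo (0 : ℝ) (1 / 2), (ε * (z / (1 + z * y)) + D) := by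
      refine integral_mono_of_nonneg ?_ ((hint.const_mul ε).add hintD) ?_
      · refine (ae_restrict_iff' measurableSet_Ioo).2 (.of_forall fun y hy => div_nonneg ?_ ?_)
        · have : -z * y ≤ 0 := by nlinarith [hy.1]
          linarith [Real.exp_le_one_iff.2 this]
        · exact mul_nonneg hy.1.le (Real.rpow_nonneg (log_one_div_pos hy).le γ)
      · refine (ae_restrict_iff' measurableSet_Ioo).2 (.of_forall fun y hy => ?_)
        have hy₀ := hy.1
        have hzy : 0 ≤ z * y := by positivity
        have h₁ := one_sub_exp_neg_le hzy
        rw [← neg_mul] at h₁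
        have h₂ : 1 - Real.exp (-z * y) ≤ 1 := by linarith [Real.exp_pos (-z * y)]
        have h₀ : 0 ≤ 1 - Real.exp (-z * y) := by
          rw [neg_mul]
          linarith [Real.exp_le_one_iff.2 (neg_nonpos.2 hzy)]
        calc
          _ = (1 - Real.exp (-z * y)) / y * (Real.log (1 / y) ^ γ)⁻¹ := by
            beta_reduce
            rw [← div_div, div_eq_mul_inv]
          _ ≤ (1 - Real.exp (-z * y)) / y * (ε / 2 + D * y) := by
            gcongr
            exact hle y hy
          _ = (1 - Real.exp (-z * y)) / y * (ε / 2) + D * (1 - Real.exp (-z * y)) := by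
            field_simp
          _ ≤ (2 * (z * y) / (1 + z * y)) / y * (ε / 2) + D * 1 := by gcongr
          _ = _ := by field_simp
    _ = ε * Real.log (1 + z / 2) + D * (1 / 2) := by
      rw [integral_add (hint.const_mul ε) hintD, integral_const_mul, heq]
      simp [mul_comm]
    _ ≤ _ := by
      gcongr
      linarith

lemma integrableOn_inv_mul_log_rpow_iff (γ : ℝ) :
    IntegrableOn (fun y => y * (1 / (y ^ 2 * Real.log (1 / y) ^ γ))) (Ioo (0 : ℝ) (1 / 2))
      ↔ 1 < γ := by
  have himg : (fun u : ℝ => Real.exp (-u)) '' Ioi (Real.log 2) = Ioo (0 : ℝ) (1 / 2) := by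
    ext y
    constructor
    · rintro ⟨u, hu, rfl⟩
      refine ⟨Real.exp_pos _, ?_⟩
      rw [one_div, ← Real.exp_log (two_pos : (0 : ℝ) < 2), ← Real.exp_neg]
      exact Real.exp_lt_exp.2 (neg_lt_neg hu)
    · intro hy
      exact ⟨Real.log (1 / y), log_two_lt_log_one_div hy, by simp [Real.exp_log hy.1]⟩
  have hderiv : ∀ u ∈ Ioi (Real.log 2), HasDerivWithinAt (fun u : ℝ => Real.exp (-u))
      (-Real.exp (-u)) (Ioi (Real.log 2)) u := fun u _ => by
    simpa using (hasDerivAt_neg u).exp.hasDerivWithinAt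
  rw [← himg, integrableOn_image_iff_integrableOn_abs_deriv_smul measurableSet_Ioi hderiv
    (fun a _ b _ h => neg_injective (Real.exp_injective h)),
    integrableOn_congr_fun (g := fun u => u ^ (-γ)) _ measurableSet_Ioi,
    integrableOn_Ioi_rpow_iff (Real.log_pos one_lt_two), neg_lt_neg_iff]
  intro u hu
  have hu₀ : 0 < u := (Real.log_pos one_lt_two).trans hu
  have := Real.rpow_pos_of_pos hu₀ γ
  have := Real.exp_pos (-u)
  simp only [abs_neg, Real.abs_exp, smul_eq_mul, one_div, Real.log_inv, Real.log_exp, neg_neg,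
    Real.rpow_neg hu₀.le]
  field_simp

/-- for the Lévy measure with density `1/(y² (log(1/y))^γ)` on
`(0, 1/2)`: (a) `J₂′(z) = ∫₀^{1/2} (1 − e^{−zy})/(y (log(1/y))^γ) dy` grows
slower than `log z`, hence `log z − a·J₂′(z) → +∞` for every `a > 0`; and
(b) the first moment `∫ y ν(dy)` is finite iff `γ > 1`. -/
theorem stmt4 (γ : ℝ) (hγ : 0 < γ) :
    Tendsto (fun z => (∫ y in Ioo (0 : ℝ) (1 / 2),
        (1 - Real.exp (-z * y)) / (y * Real.log (1 / y) ^ γ)) / Real.log z)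
      atTop (nhds 0) ∧
    (∀ a > (0 : ℝ), Tendsto (fun z => Real.log z - a * ∫ y in Ioo (0 : ℝ) (1 / 2),
        (1 - Real.exp (-z * y)) / (y * Real.log (1 / y) ^ γ)) atTop atTop) ∧
    (IntegrableOn (fun y => y * (1 / (y ^ 2 * Real.log (1 / y) ^ γ))) (Ioo (0 : ℝ) (1 / 2))
      ↔ 1 < γ) := by
  refine ⟨?_, fun a ha => ?_, integrableOn_inv_mul_log_rpow_iff γ⟩
  · rw [Metric.tendsto_nhds]
    intro ε hε
    obtain ⟨C, hC⟩ := exists_integral_one_sub_exp_le hγ (half_pos hε)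
    filter_upwards [eventually_ge_atTop 2,
      Real.tendsto_log_atTop.eventually_gt_atTop (C / (ε / 2))] with z hz hlog
    have hL : 0 < Real.log z := Real.log_pos (by linarith)
    rw [Real.dist_0_eq_abs,
      abs_of_nonneg (div_nonneg (integral_one_sub_exp_nonneg γ (by linarith)) hL.le),
      div_lt_iff₀ hL]
    rw [div_lt_iff₀ (half_pos hε)] at hlog
    linarith [hC z hz]
  · obtain ⟨C, hC⟩ := exists_integral_one_sub_exp_le hγ (ε := 1 / (2 * a)) (by positivity)
    refine tendsto_atTop_mono' atTop ?_
      (tendsto_atTop_add_const_right atTop (-(a * C))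
        (Real.tendsto_log_atTop.const_mul_atTop (half_pos one_pos)))
    filter_upwards [eventually_ge_atTop 2] with z hz
    have h := mul_le_mul_of_nonneg_left (hC z hz) ha.le
    have : a * (1 / (2 * a) * Real.log z + C) = 1 / 2 * Real.log z + a * C := by field_simp
    linarith
end

section
/- Fix T* > 0 and set 𝒯 := {(t,T) ∈ ℝ² : 0 ≤ t ≤ T ≤ T*}. Let J′ : [0, ∞) → ℝ be monotone increasing, let λ̲, λ̄ with 0 < λ̲ ≤ λ̄ < ∞, let λ : 𝒯 → ℝ be measurable with λ̲ ≤ λ(t,T) ≤ λ̄ for all (t,T) ∈ 𝒯, and let a : 𝒯 → (0, ∞) be measurable with A := sup_{(t,T)∈𝒯} a(t,T) < ∞. Let f : [0,T*]² → [0, ∞) be measurable and satisfy f(t,T) = a(t,T)·exp(∫₀ᵗ J′(∫ₛᵀ λ(s,u) f(s,u) du) λ(s,T) ds) for all (t,T) ∈ 𝒯. If I := ∫₀^{T*} J′(λ̄ ∫₀^{T*} f(s,u) du) ds < ∞, then f is bounded on 𝒯; more precisely, f(t,T) ≤ exp(λ̄·I + λ̄·T*·|J′(0)|)·A for all (t,T)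 ∈ 𝒯. -/
open MeasureTheory Set intervalIntegral

/-- Monotonicity of the interval integral, without integrability of the smaller integrand,
provided the larger integrand is nonnegative. -/
lemma intervalIntegral_le_of_le_of_nonneg {a b : ℝ} (hab : a ≤ b) {f g : ℝ → ℝ}
    (hg : IntervalIntegrable g volume a b) (hg0 : ∀ x ∈ Icc a b, 0 ≤ g x)
    (hfg : ∀ x ∈ Icc a b, f x ≤ g x) : ∫ x in a..b, f x ≤ ∫ x in a..b, g x := by
  by_cases hf : IntervalIntegrable f volume a b
  · exact integral_mono_on hab hf hg hfg
  · rw [integral_undef hf]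
    exact integral_nonneg hab hg0

/-- an integrability condition on a solution of the HJM fixed-point
equation forces the solution to be bounded on the triangle
`𝒯 = {(t,T) : 0 ≤ t ≤ T ≤ T*}`, with the explicit bound
`f(t,T) ≤ exp(λ̄·I + λ̄·T*·|J′(0)|)·A`. -/
theorem stmt6 (Tstar : ℝ) (hTstar : 0 < Tstar)
    (J' : ℝ → ℝ) (hJmono : MonotoneOn J' (Ici 0))
    (lamL lamU : ℝ) (hlamL : 0 < lamL) (hlamLU : lamL ≤ lamU)
    (lam : ℝ → ℝ → ℝ) (hlam_meas : Measurable (Function.uncurry lam))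
    (hlam_bdd : ∀ t T, 0 ≤ t → t ≤ T → T ≤ Tstar → lamL ≤ lam t T ∧ lam t T ≤ lamU)
    (a : ℝ → ℝ → ℝ) (ha_meas : Measurable (Function.uncurry a))
    (ha_pos : ∀ t T, 0 ≤ t → t ≤ T → T ≤ Tstar → 0 < a t T)
    (A : ℝ) (hA : ∀ t T, 0 ≤ t → t ≤ T → T ≤ Tstar → a t T ≤ A)
    (f : ℝ → ℝ → ℝ) (hf_meas : Measurable (Function.uncurry f))
    (hf_nonneg : ∀ t T, 0 ≤ f t T)
    (hf_int : ∀ s ∈ Icc (0 : ℝ) Tstar, IntegrableOn (f s) (Icc 0 Tstar))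
    (hfix : ∀ t T, 0 ≤ t → t ≤ T → T ≤ Tstar →
      f t T = a t T * Real.exp (∫ s in (0 : ℝ)..t,
        J' (∫ u in s..T, lam s u * f s u) * lam s T))
    (hI_int : IntegrableOn (fun s => J' (lamU * ∫ u in (0 : ℝ)..Tstar, f s u))
      (Icc 0 Tstar))
    (I : ℝ) (hI : I = ∫ s in (0 : ℝ)..Tstar, J' (lamU * ∫ u in (0 : ℝ)..Tstar, f s u)) :
    ∀ t T, 0 ≤ t → t ≤ T → T ≤ Tstar →
      f t T ≤ Real.exp (lamU * I + lamU * Tstar * |J' 0|) * A := by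
  intro t T ht htT hTT
  have hU : 0 ≤ lamU := hlamL.le.trans hlamLU
  have hA0 : 0 ≤ A := (ha_pos t T ht htT hTT).le.trans (hA t T ht htT hTT)
  have hY0 : ∀ s, 0 ≤ lamU * ∫ u in (0 : ℝ)..Tstar, f s u := fun s =>
    mul_nonneg hU (integral_nonneg hTstar.le fun u _ => hf_nonneg s u)
  set g : ℝ → ℝ := fun s => J' (lamU * ∫ u in (0 : ℝ)..Tstar, f s u) with hg
  have hg0 : ∀ s, 0 ≤ g s + |J' 0| := fun s => by
    have h : J' 0 ≤ g s := hJmono self_mem_Ici (hY0 s) (hY0 s)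
    linarith [neg_abs_le (J' 0)]
  have hgi : IntervalIntegrable g volume 0 Tstar :=
    (intervalIntegrable_iff_integrableOn_Icc_of_le hTstar.le).2 hI_int
  have hhi : IntervalIntegrable (fun s => lamU * (g s + |J' 0|)) volume 0 Tstar :=
    (hgi.add intervalIntegrable_const).const_mul _
  have hh0 : ∀ s, 0 ≤ lamU * (g s + |J' 0|) := fun s => mul_nonneg hU (hg0 s)
  have htot : ∫ s in (0 : ℝ)..Tstar, lamU * (g s + |J' 0|)
      = lamU * I + lamU * Tstar * |J' 0| := by
    rw [intervalIntegral.integral_const_mul, integral_add hgi intervalIntegrable_const,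
      intervalIntegral.integral_const, hI, smul_eq_mul]
    ring
  have hinner : ∀ s ∈ Icc 0 t, ∫ u in s..T, lam s u * f s u
      ≤ lamU * ∫ u in (0 : ℝ)..Tstar, f s u := by
    intro s hs
    have hsT : s ≤ T := hs.2.trans htT
    have hfi : IntervalIntegrable (f s) volume 0 Tstar :=
      (intervalIntegrable_iff_integrableOn_Icc_of_le hTstar.le).2
        (hf_int s ⟨hs.1, hsT.trans hTT⟩)
    rw [← intervalIntegral.integral_const_mul]
    refine (intervalIntegral_le_of_le_of_nonneg (g := fun u => lamU * f s u) hsT ?_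
      (fun u _ => mul_nonneg hU (hf_nonneg s u)) fun u hu => ?_).trans ?_
    · refine (hfi.const_mul lamU).mono_set ?_
      rw [uIcc_of_le hsT, uIcc_of_le hTstar.le]
      exact Icc_subset_Icc hs.1 hTT
    · exact mul_le_mul_of_nonneg_right (hlam_bdd s u hs.1 hu.1 (hu.2.trans hTT)).2
        (hf_nonneg s u)
    · exact integral_mono_interval hs.1 hsT hTT
        (Filter.Eventually.of_forall fun u => mul_nonneg hU (hf_nonneg s u))
        (hfi.const_mul lamU)
  have hexp : ∫ s in (0 : ℝ)..t, J' (∫ u in s..T, lam s u * f s u) * lam s T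
      ≤ lamU * I + lamU * Tstar * |J' 0| := by
    rw [← htot]
    refine (intervalIntegral_le_of_le_of_nonneg (g := fun s => lamU * (g s + |J' 0|)) ht ?_
      (fun s _ => hh0 s) fun s hs => ?_).trans ?_
    · refine hhi.mono_set ?_
      rw [uIcc_of_le ht, uIcc_of_le hTstar.le]
      exact Icc_subset_Icc le_rfl (htT.trans hTT)
    · have hsT : s ≤ T := hs.2.trans htT
      have hX0 : 0 ≤ ∫ u in s..T, lam s u * f s u := integral_nonneg hsT fun u hu =>
        mul_nonneg (hlamL.le.trans (hlam_bdd s u hs.1 hu.1 (hu.2.trans hTT)).1)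
          (hf_nonneg s u)
      have hJ : J' (∫ u in s..T, lam s u * f s u) ≤ g s :=
        hJmono hX0 (hY0 s) (hinner s hs)
      obtain ⟨hl, hu⟩ := hlam_bdd s T hs.1 hsT hTT
      calc J' (∫ u in s..T, lam s u * f s u) * lam s T
          ≤ (g s + |J' 0|) * lam s T :=
            mul_le_mul_of_nonneg_right (by linarith [abs_nonneg (J' 0)]) (hlamL.le.trans hl)
        _ ≤ (g s + |J' 0|) * lamU := mul_le_mul_of_nonneg_left hu (hg0 s)
        _ = lamU * (g s + |J' 0|) := mul_comm _ _
    · exact integral_mono_interval le_rfl ht (htT.trans hTT)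
        (Filter.Eventually.of_forall hh0) hhi
  rw [hfix t T ht htT hTT, mul_comm]
  exact mul_le_mul (Real.exp_le_exp.2 hexp) (hA t T ht htT hTT)
    (ha_pos t T ht htT hTT).le (Real.exp_pos _).le
end

section
/- Fix T* > 0 and set 𝒯 := {(t,T) ∈ ℝ² : 0 ≤ t ≤ T ≤ T*}; for (x,y) ∈ 𝒯 set 𝒯_{x,y} := {(t,T) ∈ 𝒯 : t ≤ x and T ≤ y}. Let α > 0 and γ ≥ 1 satisfy αγ > 2 and γT* > 1, and let (x,y) satisfy 0 < x < y < min(α/2, T*) and γ(y − x) > 1. Define h(t,T) := exp(1/(x − t + y − T)) for (t,T) ∈ 𝒯_{x,y} with (t,T) ≠ (x,y), and R_{α,γ}(z) := α·(log(γ·(z + e²)))³ for z ≥ 0. Then the function g : 𝒯_{x,y} → [0, ∞) defined by g(t,T) := exp(−∫₀ᵗ R_{α,γ}(∫ₛᵀ h(s,u) du) ds)·h(t,T) for (t,T) ≠ (x,y) and g(x,y) := 0 is continuous on 𝒯_{x,y}; in particular g(t,T) → 0 as (t,T) → (x,y) within 𝒯_{x,y}. -/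
open MeasureTheory Set intervalIntegral

open Filter Topology

/-- The integrand `R_{α,γ}(∫ₛᵀ h(s,u) du)` as a function of `s` and `T`. -/
noncomputable def rate (α γ x y s T : ℝ) : ℝ :=
  α * Real.log (γ * ((∫ u in s..T, Real.exp (1 / (x - s + y - u))) + Real.exp 2)) ^ 3

/-- A globally continuous truncation of `rate`, which agrees with it where `δ ≤ x - s + y - T`. -/
noncomputable def truncRate (δ α γ x y s T : ℝ) : ℝ :=
  α * Real.log (max 1 (γ * ((∫ u in s..T, Real.exp (1 / max δ (x - s + y - u)))
    + Real.exp 2))) ^ 3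

lemma continuous_truncRate {X : Type*} [TopologicalSpace X] {δ : ℝ} (hδ : 0 < δ) (α γ x y : ℝ)
    {f g : X → ℝ} (hf : Continuous f) (hg : Continuous g) :
    Continuous fun q => truncRate δ α γ x y (f q) (g q) := by
  have hmax (z : ℝ) : max δ z ≠ 0 := (lt_max_of_lt_left hδ).ne'
  have hK : Continuous fun q : X × ℝ =>
      Real.exp (1 / max δ (x - f q.1 + y - q.2)) :=
    Real.continuous_exp.comp (continuous_const.div (by fun_prop) fun _ => hmax _)
  have hint : Continuous fun q : X =>
      ∫ u in f q..g q, Real.exp (1 / max δ (x - f q + y - u)) := by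
    have hsub (q : X) : ∫ u in f q..g q, Real.exp (1 / max δ (x - f q + y - u)) =
        (∫ u in (0 : ℝ)..g q, Real.exp (1 / max δ (x - f q + y - u))) -
          ∫ u in (0 : ℝ)..f q, Real.exp (1 / max δ (x - f q + y - u)) := by
      have hq : Continuous fun u : ℝ => Real.exp (1 / max δ (x - f q + y - u)) :=
        hK.comp (Continuous.prodMk_right q)
      exact (integral_interval_sub_left (hq.intervalIntegrable _ _)
        (hq.intervalIntegrable _ _)).symm
    simp_rw [hsub]
    exact (continuous_parametric_intervalIntegral_of_continuous hK hg).sub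
      (continuous_parametric_intervalIntegral_of_continuous hK hf)
  unfold truncRate
  refine continuous_const.mul (Continuous.pow (Continuous.log (by fun_prop) fun q => ?_) 3)
  exact (lt_max_of_lt_left one_pos).ne'

lemma one_le_mul_integral_add_exp {γ s T : ℝ} (hγ : 1 ≤ γ) (hsT : s ≤ T) (f : ℝ → ℝ) :
    1 ≤ γ * ((∫ u in s..T, Real.exp (f u)) + Real.exp 2) := by
  have hI : 0 ≤ ∫ u in s..T, Real.exp (f u) :=
    integral_nonneg hsT fun u _ => (Real.exp_pos _).le
  have he : 1 ≤ Real.exp 2 := Real.one_le_exp (by norm_num)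
  nlinarith

lemma truncRate_eq_rate {δ γ x y s T : ℝ} (α : ℝ) (hγ : 1 ≤ γ) (hsT : s ≤ T)
    (hδ : δ ≤ x - s + y - T) : truncRate δ α γ x y s T = rate α γ x y s T := by
  have hI : ∫ u in s..T, Real.exp (1 / max δ (x - s + y - u)) =
      ∫ u in s..T, Real.exp (1 / (x - s + y - u)) := by
    refine integral_congr fun u hu => ?_
    rw [uIcc_of_le hsT] at hu
    rw [max_eq_right (by linarith [hu.2])]
  rw [truncRate, rate, hI, max_eq_right (one_le_mul_integral_add_exp hγ hsT _)]

lemma eqOn_truncRate_rate {δ γ x y t T : ℝ} (α : ℝ) (hγ : 1 ≤ γ) (ht : 0 ≤ t) (htT : t ≤ T)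
    (hδ : δ ≤ x - t + y - T) :
    EqOn (fun s => truncRate δ α γ x y s T) (fun s => rate α γ x y s T) (uIcc 0 t) := by
  intro s hs
  rw [uIcc_of_le ht] at hs
  exact truncRate_eq_rate α hγ (hs.2.trans htT) (by linarith [hs.2])

lemma intervalIntegrable_rate {γ x y t T : ℝ} (α : ℝ) (hγ : 1 ≤ γ) (ht : 0 ≤ t) (htT : t ≤ T)
    (hr : 0 < x - t + y - T) :
    IntervalIntegrable (fun s => rate α γ x y s T) volume 0 t := by
  have hc : Continuous fun s => truncRate (x - t + y - T) α γ x y s T :=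
    continuous_truncRate hr α γ x y continuous_id continuous_const
  refine (hc.intervalIntegrable 0 t).congr ?_
  exact (eqOn_truncRate_rate α hγ ht htT le_rfl).mono uIoc_subset_uIcc

lemma rate_nonneg {α γ s T : ℝ} (x y : ℝ) (hα : 0 ≤ α) (hγ : 1 ≤ γ) (hsT : s ≤ T) :
    0 ≤ rate α γ x y s T :=
  mul_nonneg hα (pow_nonneg (Real.log_nonneg (one_le_mul_integral_add_exp hγ hsT _)) 3)

lemma le_rate {α γ x y s t T r : ℝ} (hα : 0 ≤ α) (hγ : 1 ≤ γ) (hr : r = x - t + y - T)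
    (hr0 : 0 < r) (hr1 : r ≤ 1 / 72) (hrT : r ≤ T - t) (hs : t - r ≤ s) (hst : s ≤ t) :
    α * (1 / (6 * r)) ^ 3 ≤ rate α γ x y s T := by
  have hpos {u : ℝ} (hu : u ≤ T) : 0 < x - s + y - u := by linarith
  have hcont : ContinuousOn (fun u => Real.exp (1 / (x - s + y - u))) (Icc s T) :=
    Real.continuous_exp.comp_continuousOn
      (continuousOn_const.div (by fun_prop) fun u hu => (hpos hu.2).ne')
  have hsub : ∫ u in (T - r)..T, Real.exp (1 / (x - s + y - u)) ≤
      ∫ u in s..T, Real.exp (1 / (x - s + y - u)) :=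
    integral_mono_interval (by linarith) (by linarith) le_rfl
      (Eventually.of_forall fun u => (Real.exp_pos _).le)
      (hcont.intervalIntegrable_of_Icc (by linarith))
  have hlow : r * Real.exp (1 / (3 * r)) ≤ ∫ u in (T - r)..T, Real.exp (1 / (x - s + y - u)) := by
    have hconst : ∫ _ in (T - r)..T, Real.exp (1 / (3 * r)) = r * Real.exp (1 / (3 * r)) := by
      simp
    rw [← hconst]
    refine integral_mono_on (by linarith) intervalIntegrable_const
      ((hcont.mono (Icc_subset_Icc_left (by linarith))).intervalIntegrable_of_Icc
        (by linarith)) fun u hu => ?_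
    exact Real.exp_le_exp.2 (one_div_le_one_div_of_le (hpos hu.2) (by linarith [hu.1]))
  have hone : 1 ≤ r * Real.exp (1 / (6 * r)) := by
    have hq := Real.quadratic_le_exp_of_nonneg (x := 1 / (6 * r)) (by positivity)
    have hz : 1 ≤ r * ((1 / (6 * r)) ^ 2 / 2) := by
      have : r * ((1 / (6 * r)) ^ 2 / 2) = 1 / (72 * r) := by field_simp; norm_num
      rw [this, le_div_iff₀ (by positivity)]
      linarith
    have hz' : 0 < 1 / (6 * r) := by positivity
    exact hz.trans (mul_le_mul_of_nonneg_left (by linarith) hr0.le)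
  have hexp : Real.exp (1 / (6 * r)) ≤ r * Real.exp (1 / (3 * r)) := by
    have hsplit : Real.exp (1 / (3 * r)) = Real.exp (1 / (6 * r)) * Real.exp (1 / (6 * r)) := by
      rw [← Real.exp_add]; congr 1; field_simp; norm_num
    rw [hsplit]
    nlinarith [Real.exp_pos (1 / (6 * r))]
  have hlog : 1 / (6 * r) ≤
      Real.log (γ * ((∫ u in s..T, Real.exp (1 / (x - s + y - u))) + Real.exp 2)) := by
    have he := Real.exp_pos 2
    have he' := Real.exp_pos (1 / (6 * r))
    rw [Real.le_log_iff_exp_le (by nlinarith)]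
    nlinarith
  unfold rate
  gcongr

lemma le_integral_rate {α γ x y t T r : ℝ} (hα : 0 ≤ α) (hγ : 1 ≤ γ)
    (hr : r = x - t + y - T) (hr0 : 0 < r) (hr1 : r ≤ 1 / 72) (hrt : r ≤ t) (hrT : r ≤ T - t) :
    α / 216 * (1 / r) ^ 2 ≤ ∫ s in (0 : ℝ)..t, rate α γ x y s T := by
  have hint := intervalIntegrable_rate (x := x) (y := y) α hγ (hr0.le.trans hrt)
    (by linarith : t ≤ T) (by linarith)
  calc α / 216 * (1 / r) ^ 2 = ∫ _ in (t - r)..t, α * (1 / (6 * r)) ^ 3 := by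
        rw [intervalIntegral.integral_const, smul_eq_mul]; field_simp; ring
    _ ≤ ∫ s in (t - r)..t, rate α γ x y s T := by
        refine integral_mono_on (by linarith) intervalIntegrable_const (hint.mono_set ?_)
          fun s hs => le_rate hα hγ hr hr0 hr1 hrT hs.1 hs.2
        rw [uIcc_of_le (by linarith), uIcc_of_le (by linarith)]
        exact Icc_subset_Icc_left (by linarith)
    _ ≤ ∫ s in (0 : ℝ)..t, rate α γ x y s T := by
        refine integral_mono_interval (by linarith) (by linarith) le_rfl ?_ hint
        filter_upwards [ae_restrict_mem measurableSet_Ioc] with s hs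
        exact rate_nonneg x y hα hγ (by linarith [hs.2])

lemma tendsto_exp_neg_mul_sq_mul_exp {c : ℝ} (hc : 0 < c) :
    Tendsto (fun w : ℝ => Real.exp (-(c * w ^ 2)) * Real.exp w) atTop (𝓝 0) := by
  simp_rw [← Real.exp_add]
  refine Real.tendsto_exp_atBot.comp ?_
  have h : Tendsto (fun w : ℝ => w * (1 + -c * w)) atTop atBot :=
    tendsto_id.atTop_mul_atBot₀ (tendsto_atBot_add_const_left _ _
      (tendsto_id.const_mul_atTop_of_neg (neg_lt_zero.2 hc)))
  exact h.congr fun w => by ring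

lemma continuousWithinAt_exp_neg_integral_rate {α γ x y : ℝ} (hγ : 1 ≤ γ) {p : ℝ × ℝ}
    (hp0 : p ∈ {q : ℝ × ℝ | 0 ≤ q.1 ∧ q.1 ≤ q.2}) (hp : 0 < x - p.1 + y - p.2) :
    ContinuousWithinAt
      (fun q : ℝ × ℝ => Real.exp (-∫ s in (0 : ℝ)..q.1, rate α γ x y s q.2)
        * Real.exp (1 / (x - q.1 + y - q.2))) {q | 0 ≤ q.1 ∧ q.1 ≤ q.2} p := by
  obtain ⟨δ, hδ, hδp⟩ := exists_between hp
  have hev : ∀ᶠ q : ℝ × ℝ in 𝓝 p, δ < x - q.1 + y - q.2 :=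
    continuousAt_const.eventually_lt (g := fun q : ℝ × ℝ => x - q.1 + y - q.2)
      (by fun_prop) hδp
  have hint : Continuous fun q : ℝ × ℝ => ∫ s in (0 : ℝ)..q.1, truncRate δ α γ x y s q.2 :=
    continuous_parametric_intervalIntegral_of_continuous
      (f := fun (q : ℝ × ℝ) s => truncRate δ α γ x y s q.2)
      (continuous_truncRate hδ α γ x y continuous_snd (continuous_snd.comp continuous_fst))
      continuous_fst
  have hexp : ContinuousWithinAt (fun q : ℝ × ℝ => Real.exp (1 / (x - q.1 + y - q.2)))
      {q | 0 ≤ q.1 ∧ q.1 ≤ q.2} p :=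
    (ContinuousAt.rexp (ContinuousAt.div (f := fun _ => 1)
      (g := fun q : ℝ × ℝ => x - q.1 + y - q.2) continuousAt_const (by fun_prop)
      hp.ne')).continuousWithinAt
  refine ContinuousWithinAt.mul ?_ hexp
  have heq (q : ℝ × ℝ) (hq : q ∈ {q : ℝ × ℝ | 0 ≤ q.1 ∧ q.1 ≤ q.2})
      (hqδ : δ < x - q.1 + y - q.2) :
      Real.exp (-∫ s in (0 : ℝ)..q.1, rate α γ x y s q.2) =
        Real.exp (-∫ s in (0 : ℝ)..q.1, truncRate δ α γ x y s q.2) := by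
    rw [integral_congr (eqOn_truncRate_rate α hγ hq.1 hq.2 hqδ.le)]
  refine (Real.continuous_exp.comp hint.neg).continuousWithinAt.congr_of_eventuallyEq_of_mem
    ?_ hp0
  filter_upwards [self_mem_nhdsWithin, nhdsWithin_le_nhds hev] with q hq hqδ
  exact heq q hq hqδ

lemma sub_add_sub_pos_of_ne {x y : ℝ} {p : ℝ × ℝ} (hp : p ≠ (x, y)) (h1 : p.1 ≤ x)
    (h2 : p.2 ≤ y) : 0 < x - p.1 + y - p.2 := by
  by_contra! h
  exact hp (Prod.ext (by dsimp only; linarith) (by dsimp only; linarith))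

lemma continuousWithinAt_ite_exp_neg_integral_rate {α γ x y : ℝ} (hα : 0 < α) (hγ : 1 ≤ γ)
    (hx : 0 < x) (hxy : x < y) :
    ContinuousWithinAt
      (fun p : ℝ × ℝ => if p = (x, y) then 0
        else Real.exp (-∫ s in (0 : ℝ)..p.1, rate α γ x y s p.2)
          * Real.exp (1 / (x - p.1 + y - p.2))) {p | p.1 ≤ x ∧ p.2 ≤ y} (x, y) := by
  rw [← continuousWithinAt_sdiff_self, ContinuousWithinAt, if_pos rfl]
  set S : Set (ℝ × ℝ) := {p | p.1 ≤ x ∧ p.2 ≤ y} \ {(x, y)}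
  have hpos : ∀ᶠ p in 𝓝[S] (x, y), 0 < x - p.1 + y - p.2 := by
    filter_upwards [self_mem_nhdsWithin] with p hp
    exact sub_add_sub_pos_of_ne hp.2 hp.1.1 hp.1.2
  have hr : Continuous fun p : ℝ × ℝ => x - p.1 + y - p.2 := by fun_prop
  have hsmall {f : ℝ × ℝ → ℝ} (hf : Continuous f) (hf0 : 0 < f (x, y)) :
      ∀ᶠ p in 𝓝[S] (x, y), x - p.1 + y - p.2 < f p :=
    nhdsWithin_le_nhds (hr.continuousAt.eventually_lt hf.continuousAt (by simpa using hf0))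
  have hw : Tendsto (fun p : ℝ × ℝ => 1 / (x - p.1 + y - p.2)) (𝓝[S] (x, y)) atTop := by
    simp_rw [one_div]
    refine tendsto_inv_nhdsGT_zero.comp (tendsto_nhdsWithin_iff.2 ⟨?_, hpos⟩)
    have := hr.tendsto (x, y)
    simp only [sub_self, zero_add] at this
    exact this.mono_left nhdsWithin_le_nhds
  refine squeeze_zero' ?_ ?_
    ((tendsto_exp_neg_mul_sq_mul_exp (c := α / 216) (by positivity)).comp hw)
  · exact Eventually.of_forall fun p => by positivity
  · filter_upwards [self_mem_nhdsWithin, hpos,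
      hsmall continuous_const (by norm_num : (0 : ℝ) < 1 / 72), hsmall continuous_fst hx,
      hsmall (continuous_snd.sub continuous_fst) (sub_pos.2 hxy)]
      with p hp hp0 hp1 hpt hpT
    rw [if_neg (show p ≠ (x, y) from hp.2)]
    dsimp only [Function.comp]
    gcongr
    exact le_integral_rate hα.le hγ rfl hp0 hp1.le hpt.le hpT.le

/-- the function `g(t,T) = exp(−∫₀ᵗ R_{α,γ}(∫ₛᵀ h(s,u) du) ds)·h(t,T)`
(with `g(x,y) := 0`), built from the blowing-up function
`h(t,T) = exp(1/(x−t+y−T))` and `R_{α,γ}(z) = α·(log(γ(z+e²)))³`, is continuous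
on the set `𝒯_{x,y}`; in particular `g(t,T) → 0` as `(t,T) → (x,y)`. -/
theorem stmt7 (Tstar : ℝ) (hTstar : 0 < Tstar)
    (α γ x y : ℝ) (hα : 0 < α) (hγ : 1 ≤ γ) (hαγ : 2 < α * γ) (hγT : 1 < γ * Tstar)
    (hx : 0 < x) (hxy : x < y) (hy : y < min (α / 2) Tstar) (hgap : 1 < γ * (y - x)) :
    ContinuousOn
      (fun p : ℝ × ℝ =>
        if p = (x, y) then 0
        else Real.exp (-∫ s in (0 : ℝ)..p.1,
            α * Real.log (γ * ((∫ u in s..p.2, Real.exp (1 / (x - s + y - u))) + Real.exp 2)) ^ 3)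
          * Real.exp (1 / (x - p.1 + y - p.2)))
      {p : ℝ × ℝ | 0 ≤ p.1 ∧ p.1 ≤ p.2 ∧ p.2 ≤ Tstar ∧ p.1 ≤ x ∧ p.2 ≤ y} := by
  rintro p ⟨h0, h12, -, h1, h2⟩
  change ContinuousWithinAt (fun p : ℝ × ℝ => if p = (x, y) then 0
    else Real.exp (-∫ s in (0 : ℝ)..p.1, rate α γ x y s p.2)
      * Real.exp (1 / (x - p.1 + y - p.2))) _ p
  by_cases hp : p = (x, y)
  · subst hp
    exact (continuousWithinAt_ite_exp_neg_integral_rate hα hγ hx hxy).mono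
      fun q hq => ⟨hq.2.2.2.1, hq.2.2.2.2⟩
  · have hr : 0 < x - p.1 + y - p.2 := sub_add_sub_pos_of_ne hp h1 h2
    refine ((continuousWithinAt_exp_neg_integral_rate hγ ⟨h0, h12⟩ hr).mono
      fun q hq => ⟨hq.1, hq.2.1⟩).congr_of_eventuallyEq ?_ (if_neg hp)
    filter_upwards [nhdsWithin_le_nhds (isOpen_ne.mem_nhds hp)] with q hq
    exact if_neg hq
end

section
/- Let α > 0 and γ ≥ 1 and define R_{α,γ}(z) := α·(log(γ·(z + e²)))³ for z ≥ 0. Then R_{α,γ} is concave on [0, ∞), it is differentiable at 0 with R_{α,γ}′(0) = 3α(2 + log γ)²/e², and it satisfies the Lipschitz bound |R_{α,γ}(z₁) − R_{α,γ}(z₂)| ≤ (3α(2 + log γ)²/e²)·|z₁ − z₂| for all z₁, z₂ ≥ 0. -/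
open Set

theorem two_le_log_mul_add_exp_two {γ z : ℝ} (hγ : 1 ≤ γ) (hz : 0 ≤ z) :
    2 ≤ Real.log (γ * (z + Real.exp 2)) := by
  have he := Real.exp_pos 2
  rw [Real.le_log_iff_exp_le (by positivity)]
  nlinarith

theorem hasDerivAt_log_mul_add_cubed (α : ℝ) {γ c z : ℝ} (hγ : γ ≠ 0) (hz : z + c ≠ 0) :
    HasDerivAt (fun z => α * Real.log (γ * (z + c)) ^ 3)
      (3 * α * (Real.log (γ * (z + c)) ^ 2 / (z + c))) z := by
  have h := (((((hasDerivAt_id z).add_const c).const_mul γ).log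
    (mul_ne_zero hγ hz)).pow 3).const_mul α
  refine h.congr_deriv ?_
  simp only [id]
  field_simp
  norm_num

theorem antitoneOn_log_sq_div {γ : ℝ} (hγ : 1 ≤ γ) :
    AntitoneOn (fun z => Real.log (γ * (z + Real.exp 2)) ^ 2 / (z + Real.exp 2)) (Ici 0) := by
  intro x hx y hy hxy
  have hx' : (0 : ℝ) ≤ x := hx
  have hy' : (0 : ℝ) ≤ y := hy
  have he := Real.exp_pos 2
  have hγ' : 0 < γ := by linarith
  have hL := two_le_log_mul_add_exp_two hγ hx'
  have hpx : 0 < x + Real.exp 2 := by positivity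
  have hpy : 0 < y + Real.exp 2 := by positivity
  have hmono : Real.log (γ * (x + Real.exp 2)) ≤ Real.log (γ * (y + Real.exp 2)) :=
    Real.log_le_log (by positivity) (by gcongr)
  obtain ⟨t, ht⟩ : ∃ t, Real.log (γ * (y + Real.exp 2)) =
      Real.log (γ * (x + Real.exp 2)) + t := ⟨_, (add_sub_cancel _ _).symm⟩
  have hw : y + Real.exp 2 = (x + Real.exp 2) * Real.exp t := by
    have h := congrArg Real.exp ht
    rw [Real.exp_add, Real.exp_log (by positivity), Real.exp_log (by positivity), mul_assoc] at h
    exact mul_left_cancel₀ hγ'.ne' h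
  have ht0 : 0 ≤ t := by linarith
  have hexp : (1 + t / 2) ^ 2 ≤ Real.exp t := by
    have h : Real.exp t = Real.exp (t / 2) ^ 2 := by
      rw [← Real.exp_nat_mul]; congr 1; push_cast; ring
    rw [h]
    gcongr
    linarith [Real.add_one_le_exp (t / 2)]
  change _ / _ ≤ _ / _
  rw [div_le_div_iff₀ hpy hpx, ht, hw]
  generalize Real.log (γ * (x + Real.exp 2)) = L at hL
  calc (L + t) ^ 2 * (x + Real.exp 2)
      ≤ (L * (1 + t / 2)) ^ 2 * (x + Real.exp 2) := by
        gcongr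
        nlinarith
    _ = L ^ 2 * ((x + Real.exp 2) * (1 + t / 2) ^ 2) := by ring
    _ ≤ L ^ 2 * ((x + Real.exp 2) * Real.exp t) := by gcongr

/-- the function `R_{α,γ}(z) = α·(log(γ(z+e²)))³` is concave on
`[0,∞)`, has (right) derivative `3α(2+log γ)²/e²` at `0`, and is Lipschitz on
`[0,∞)` with that constant. -/
theorem stmt8 (α γ : ℝ) (hα : 0 < α) (hγ : 1 ≤ γ)
    (R : ℝ → ℝ) (hR : ∀ z, R z = α * Real.log (γ * (z + Real.exp 2)) ^ 3) :
    ConcaveOn ℝ (Ici 0) R ∧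
    HasDerivWithinAt R (3 * α * (2 + Real.log γ) ^ 2 / Real.exp 2) (Ici 0) 0 ∧
    ∀ z₁ ∈ Ici (0 : ℝ), ∀ z₂ ∈ Ici (0 : ℝ),
      |R z₁ - R z₂| ≤ 3 * α * (2 + Real.log γ) ^ 2 / Real.exp 2 * |z₁ - z₂| := by
  obtain rfl : R = fun z => α * Real.log (γ * (z + Real.exp 2)) ^ 3 := funext hR
  have he := Real.exp_pos 2
  have hγ' : γ ≠ 0 := by linarith
  have hpos : ∀ z ∈ Ici (0 : ℝ), 0 < z + Real.exp 2 := fun z hz => add_pos_of_nonneg_of_pos hz he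
  have hderiv := fun z (hz : z ∈ Ici (0 : ℝ)) =>
    hasDerivAt_log_mul_add_cubed α hγ' (hpos z hz).ne'
  have hzero : 3 * α * (Real.log (γ * (0 + Real.exp 2)) ^ 2 / (0 + Real.exp 2)) =
      3 * α * (2 + Real.log γ) ^ 2 / Real.exp 2 := by
    rw [zero_add, Real.log_mul hγ' he.ne', Real.log_exp, add_comm, mul_div_assoc]
  refine ⟨?_, ?_, ?_⟩
  · refine AntitoneOn.concaveOn_of_deriv (convex_Ici 0)
      (fun z hz => (hderiv z hz).continuousAt.continuousWithinAt)
      (fun z hz => (hderiv z (interior_subset hz)).differentiableAt.differentiableWithinAt) ?_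
    intro x hx y hy hxy
    rw [(hderiv x (interior_subset hx)).deriv, (hderiv y (interior_subset hy)).deriv]
    exact mul_le_mul_of_nonneg_left
      (antitoneOn_log_sq_div hγ (interior_subset hx) (interior_subset hy) hxy) (by positivity)
  · rw [← hzero]
    exact (hderiv 0 self_mem_Ici).hasDerivWithinAt
  · intro x hx y hy
    refine (convex_Ici (0 : ℝ)).norm_image_sub_le_of_norm_hasDerivWithin_le
      (fun z hz => (hderiv z hz).hasDerivWithinAt) (fun z hz => ?_) hy hx
    have hz' := hpos z hz
    rw [← hzero, Real.norm_of_nonneg (by positivity)]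
    exact mul_le_mul_of_nonneg_left
      (antitoneOn_log_sq_div hγ self_mem_Ici hz hz) (by positivity)
end

section
/- Let 0 < t₀ ≤ T₀ < ∞ and define A := {(t,T) ∈ ℝ² : 0 ≤ t ≤ t₀ and t ≤ T ≤ T₀}. Let K > 0 and let d : A → [0, ∞) be a bounded measurable function satisfying d(t,T) ≤ K·∫₀ᵗ ∫ₛᵀ d(s,u) du ds for all (t,T) ∈ A. Then d(t,T) = 0 for all (t,T) ∈ A. -/
open MeasureTheory Set intervalIntegral

/-- a two-dimensional Gronwall-type lemma: a bounded nonnegative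
measurable function on the region `A = {(t,T) : 0 ≤ t ≤ t₀, t ≤ T ≤ T₀}`
satisfying `d(t,T) ≤ K ∫₀ᵗ ∫ₛᵀ d(s,u) du ds` vanishes identically on `A`. -/
theorem stmt9 (t₀ T₀ : ℝ) (ht₀ : 0 < t₀) (hT₀ : t₀ ≤ T₀)
    (K : ℝ) (hK : 0 < K)
    (d : ℝ → ℝ → ℝ) (hd_meas : Measurable (Function.uncurry d))
    (hd_nonneg : ∀ t T, 0 ≤ t → t ≤ t₀ → t ≤ T → T ≤ T₀ → 0 ≤ d t T)
    (M : ℝ) (hd_bdd : ∀ t T, 0 ≤ t → t ≤ t₀ → t ≤ T → T ≤ T₀ → d t T ≤ M)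
    (hineq : ∀ t T, 0 ≤ t → t ≤ t₀ → t ≤ T → T ≤ T₀ →
      d t T ≤ K * ∫ s in (0 : ℝ)..t, ∫ u in s..T, d s u) :
    ∀ t T, 0 ≤ t → t ≤ t₀ → t ≤ T → T ≤ T₀ → d t T = 0 := by
  have bound : ∀ n : ℕ, ∀ t T, 0 ≤ t → t ≤ t₀ → t ≤ T → T ≤ T₀ →
      d t T ≤ M * ((K * T₀ * t) ^ n / n.factorial) := by
    intro n
    induction n with
    | zero => simpa using hd_bdd
    | succ n ih =>
      intro t T h0 ht htT hT
      have hM : 0 ≤ M := (hd_nonneg t T h0 ht htT hT).trans (hd_bdd t T h0 ht htT hT)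
      refine (hineq t T h0 ht htT hT).trans ?_
      have inner : ∀ s ∈ Ioc 0 t, ‖∫ u in s..T, d s u‖
          ≤ T₀ * (M * ((K * T₀) ^ n / n.factorial)) * s ^ n := by
        intro s hs
        have hsT : s ≤ T := hs.2.trans htT
        have h := intervalIntegral.norm_integral_le_of_norm_le_const (a := s) (b := T)
          (f := d s) (C := M * ((K * T₀ * s) ^ n / n.factorial)) (by
            intro u hu
            rw [uIoc_of_le hsT] at hu
            have hst := hs.2.trans ht
            rw [Real.norm_of_nonneg (hd_nonneg s u hs.1.le hst hu.1.le (hu.2.trans hT))]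
            exact ih s u hs.1.le hst hu.1.le (hu.2.trans hT))
        have hs0 := hs.1.le
        have hT0 : 0 ≤ T₀ := ht₀.le.trans hT₀
        calc _ ≤ _ := h
          _ ≤ M * ((K * T₀ * s) ^ n / n.factorial) * T₀ := by
            gcongr
            rw [abs_of_nonneg (by linarith)]
            linarith
          _ = _ := by rw [mul_pow]; ring
      have outer := intervalIntegral.norm_integral_le_of_norm_le (μ := volume) h0
        (Filter.Eventually.of_forall inner)
        ((continuous_const.mul (continuous_id.pow n)).intervalIntegrable 0 t)
      calc _ ≤ K * ∫ s in (0 : ℝ)..t, T₀ * (M * ((K * T₀) ^ n / n.factorial)) * s ^ n := by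
            gcongr
            exact (Real.le_norm_self _).trans outer
        _ = _ := by
          rw [intervalIntegral.integral_const_mul, integral_pow, Nat.factorial_succ]
          push_cast
          field_simp
          ring
  intro t T h0 ht htT hT
  refine le_antisymm ?_ (hd_nonneg t T h0 ht htT hT)
  have lim := (FloorSemiring.tendsto_pow_div_factorial_atTop (K * T₀ * t)).const_mul M
  rw [mul_zero] at lim
  exact ge_of_tendsto' lim fun n => bound n t T h0 ht htT hT
end

section
/- Fix T* > 0 and set 𝒯 := {(t,T) ∈ ℝ² : 0 ≤ t ≤ T ≤ T*}; for (x,y) ∈ 𝒯 set 𝒯_{x,y} := {(t,T) ∈ 𝒯 : t ≤ x and T ≤ y}. Let α > 0 and γ ≥ 1 satisfy αγ > 2 and γT* > 1, let 0 < x < y < min(α/2, T*) with γ(y − x) > 1, and let 0 < δ < y. Define R_{α,γ}(z) := α·(log(γ·(z + e²)))³ for z ≥ 0, and let g : 𝒯_{x,y−δ} → [0, ∞) be a bounded measurable function. If h₁, h₂ : 𝒯_{x,y−δ} → [0, ∞) are bounded measurable functions each satisfying hᵢ(t,T) = exp(∫₀ᵗ R_{α,γ}(∫ₛᵀ hᵢ(s,u)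 du) ds)·g(t,T) for all (t,T) ∈ 𝒯_{x,y−δ}, then h₁ = h₂ on 𝒯_{x,y−δ}. -/
open MeasureTheory Set intervalIntegral

/-- Measurability of a parametric integral in its lower limit and its parameter. -/
theorem measurable_intervalIntegral_left {h : ℝ → ℝ → ℝ}
    (hh : Measurable (Function.uncurry h)) (T : ℝ) :
    Measurable fun s => ∫ u in s..T, h s u := by
  have key : ∀ A : Set (ℝ × ℝ), MeasurableSet A →
      Measurable fun s => ∫ u, A.indicator (Function.uncurry h) (s, u) := fun A hA =>
    ((hh.indicator hA).stronglyMeasurable.integral_prod_right' (ν := volume)).measurable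
  have h1 : MeasurableSet {p : ℝ × ℝ | p.1 < p.2 ∧ p.2 ≤ T} :=
    (measurableSet_lt measurable_fst measurable_snd).inter
      (measurableSet_le measurable_snd measurable_const)
  have h2 : MeasurableSet {p : ℝ × ℝ | T < p.2 ∧ p.2 ≤ p.1} :=
    (measurableSet_lt measurable_const measurable_snd).inter
      (measurableSet_le measurable_snd measurable_fst)
  have heq : (fun s => ∫ u in s..T, h s u) = fun s =>
      (∫ u, {p : ℝ × ℝ | p.1 < p.2 ∧ p.2 ≤ T}.indicator (Function.uncurry h) (s, u)) -
      ∫ u, {p : ℝ × ℝ | T < p.2 ∧ p.2 ≤ p.1}.indicator (Function.uncurry h) (s, u) := by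
    funext s
    rw [intervalIntegral, ← MeasureTheory.integral_indicator measurableSet_Ioc,
      ← MeasureTheory.integral_indicator measurableSet_Ioc]
    rfl
  rw [heq]
  exact (key _ h1).sub (key _ h2)

/-- A measurable function bounded on `[a, b]` is interval integrable. -/
theorem intervalIntegrable_of_measurable_of_bound {f : ℝ → ℝ} (hf : Measurable f) {a b C : ℝ}
    (hab : a ≤ b) (hC : ∀ u, a ≤ u → u ≤ b → |f u| ≤ C) :
    IntervalIntegrable f volume a b := by
  rw [intervalIntegrable_iff_integrableOn_Ioc_of_le hab]
  refine Measure.integrableOn_of_bounded (M := C) (by simp) hf.aestronglyMeasurable ?_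
  filter_upwards [ae_restrict_mem measurableSet_Ioc] with u hu
  exact hC u hu.1.le hu.2

theorem abs_exp_sub_exp_le {a b K : ℝ} (ha : a ≤ K) (hb : b ≤ K) :
    |Real.exp a - Real.exp b| ≤ Real.exp K * |a - b| := by
  have key : ∀ {a b : ℝ}, a ≤ K → Real.exp a - Real.exp b ≤ Real.exp K * |a - b| := by
    intro a b ha
    have h1 := Real.add_one_le_exp (b - a)
    have h2 : Real.exp b = Real.exp a * Real.exp (b - a) := by
      rw [← Real.exp_add]; ring_nf
    have h3 : Real.exp a - Real.exp b ≤ Real.exp a * |a - b| := by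
      rw [h2]
      nlinarith [Real.exp_pos a, le_abs_self (a - b)]
    exact h3.trans (mul_le_mul_of_nonneg_right (Real.exp_le_exp.2 ha) (abs_nonneg _))
  refine abs_le.2 ⟨?_, key ha⟩
  have := key (a := b) (b := a) hb
  rw [abs_sub_comm] at this
  linarith

theorem abs_log_sub_log_le {a b : ℝ} (ha : 1 ≤ a) (hb : 1 ≤ b) :
    |Real.log a - Real.log b| ≤ |a - b| := by
  have key : ∀ {a b : ℝ}, 1 ≤ a → 1 ≤ b → Real.log a - Real.log b ≤ |a - b| := by
    intro a b ha hb
    have hb0 : 0 < b := by linarith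
    rw [← Real.log_div (by linarith) (by linarith)]
    have h1 := Real.log_le_sub_one_of_pos (show 0 < a / b by positivity)
    have h2 : a / b - 1 = (a - b) / b := by field_simp
    have h3 : (a - b) / b ≤ |a - b| := by
      rw [div_le_iff₀ hb0]
      nlinarith [le_abs_self (a - b), abs_nonneg (a - b)]
    linarith
  refine abs_le.2 ⟨?_, key ha hb⟩
  have := key hb ha
  rw [abs_sub_comm] at this
  linarith

theorem log_mul_add_exp_two_nonneg {γ z : ℝ} (hγ : 1 ≤ γ) (hz : 0 ≤ z) :
    0 ≤ Real.log (γ * (z + Real.exp 2)) := by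
  have := Real.add_one_le_exp 2
  exact Real.log_nonneg (by nlinarith)

/-- The nonlinearity `z ↦ α (log (γ (z + e²)))³` is Lipschitz on bounded intervals. -/
theorem abs_logCube_sub_le {α γ M z w : ℝ} (hα : 0 < α) (hγ : 1 ≤ γ)
    (hz : 0 ≤ z) (hzM : z ≤ M) (hw : 0 ≤ w) (hwM : w ≤ M) :
    |α * Real.log (γ * (z + Real.exp 2)) ^ 3 - α * Real.log (γ * (w + Real.exp 2)) ^ 3| ≤
      α * (3 * Real.log (γ * (M + Real.exp 2)) ^ 2) * |z - w| := by
  have he := Real.add_one_le_exp 2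
  have hγ0 : γ ≠ 0 := by linarith
  have hle : ∀ {v : ℝ}, 0 ≤ v → v ≤ M →
      Real.log (γ * (v + Real.exp 2)) ≤ Real.log (γ * (M + Real.exp 2)) := fun hv hvM =>
    Real.log_le_log (by nlinarith) (by nlinarith)
  have hp := log_mul_add_exp_two_nonneg hγ hz
  have hq := log_mul_add_exp_two_nonneg hγ hw
  have hpK := hle hz hzM
  have hqK := hle hw hwM
  have hpq : |Real.log (γ * (z + Real.exp 2)) - Real.log (γ * (w + Real.exp 2))| ≤ |z - w| := by
    rw [Real.log_mul hγ0 (by linarith), Real.log_mul hγ0 (by linarith)]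
    have := abs_log_sub_log_le (a := z + Real.exp 2) (b := w + Real.exp 2)
      (by linarith) (by linarith)
    rwa [add_sub_add_left_eq_sub, ← add_sub_add_right_eq_sub z w (Real.exp 2)]
  generalize Real.log (γ * (z + Real.exp 2)) = p at *
  generalize Real.log (γ * (w + Real.exp 2)) = q at *
  generalize Real.log (γ * (M + Real.exp 2)) = K at *
  rw [show α * p ^ 3 - α * q ^ 3 = α * (p ^ 2 + p * q + q ^ 2) * (p - q) by ring, abs_mul,
    abs_of_nonneg (show 0 ≤ α * (p ^ 2 + p * q + q ^ 2) by positivity)]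
  have h2 : p ^ 2 + p * q + q ^ 2 ≤ 3 * K ^ 2 := by nlinarith
  gcongr

/-- Uniqueness of bounded nonnegative solutions of `h = exp (∫ R (∫ h)) g` for a measurable `R`
which is bounded and Lipschitz on bounded sets. -/
theorem eq_of_exp_integral_eq {R : ℝ → ℝ} (hR : Measurable R) {x b C G K L : ℝ}
    (hRK : ∀ z, 0 ≤ z → z ≤ C * b → |R z| ≤ K)
    (hRL : ∀ z w, 0 ≤ z → z ≤ C * b → 0 ≤ w → w ≤ C * b → |R z - R w| ≤ L * |z - w|)
    (hC : 0 ≤ C) (hL : 0 ≤ L) {g h₁ h₂ : ℝ → ℝ → ℝ}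
    (hg : ∀ t T, 0 ≤ t → t ≤ T → t ≤ x → T ≤ b → 0 ≤ g t T ∧ g t T ≤ G)
    (h₁_meas : Measurable (Function.uncurry h₁)) (h₂_meas : Measurable (Function.uncurry h₂))
    (hb₁ : ∀ t T, 0 ≤ t → t ≤ T → t ≤ x → T ≤ b → 0 ≤ h₁ t T ∧ h₁ t T ≤ C)
    (hb₂ : ∀ t T, 0 ≤ t → t ≤ T → t ≤ x → T ≤ b → 0 ≤ h₂ t T ∧ h₂ t T ≤ C)
    (heq₁ : ∀ t T, 0 ≤ t → t ≤ T → t ≤ x → T ≤ b →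
      h₁ t T = Real.exp (∫ s in (0 : ℝ)..t, R (∫ u in s..T, h₁ s u)) * g t T)
    (heq₂ : ∀ t T, 0 ≤ t → t ≤ T → t ≤ x → T ≤ b →
      h₂ t T = Real.exp (∫ s in (0 : ℝ)..t, R (∫ u in s..T, h₂ s u)) * g t T)
    (t T : ℝ) (ht : 0 ≤ t) (htT : t ≤ T) (htx : t ≤ x) (hTb : T ≤ b) : h₁ t T = h₂ t T := by
  have hb0 : 0 ≤ b := by linarith
  have hG : 0 ≤ G := (hg t T ht htT htx hTb).1.trans (hg t T ht htT htx hTb).2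
  have hK : 0 ≤ K := (abs_nonneg _).trans (hRK 0 le_rfl (by positivity))
  -- Inner integrals are integrable, with values in `[0, C b]`.
  have hint : ∀ h : ℝ → ℝ → ℝ, Measurable (Function.uncurry h) →
      (∀ t T, 0 ≤ t → t ≤ T → t ≤ x → T ≤ b → 0 ≤ h t T ∧ h t T ≤ C) →
      ∀ s T, 0 ≤ s → s ≤ T → s ≤ x → T ≤ b → IntervalIntegrable (h s) volume s T := by
    intro h hm hb s T hs hsT hsx hTb
    refine intervalIntegrable_of_measurable_of_bound (C := C) hm.of_uncurry_left hsT ?_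
    intro u hu huT
    have := hb s u hs hu hsx (huT.trans hTb)
    rw [abs_of_nonneg this.1]
    exact this.2
  have hval : ∀ h : ℝ → ℝ → ℝ, Measurable (Function.uncurry h) →
      (∀ t T, 0 ≤ t → t ≤ T → t ≤ x → T ≤ b → 0 ≤ h t T ∧ h t T ≤ C) →
      ∀ s T, 0 ≤ s → s ≤ T → s ≤ x → T ≤ b →
        0 ≤ (∫ u in s..T, h s u) ∧ (∫ u in s..T, h s u) ≤ C * b := by
    intro h hm hb s T hs hsT hsx hTb
    constructor
    · exact intervalIntegral.integral_nonneg hsT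
        fun u hu => (hb s u hs hu.1 hsx (hu.2.trans hTb)).1
    · have := intervalIntegral.integral_mono_on hsT (hint h hm hb s T hs hsT hsx hTb)
        (intervalIntegrable_const (c := C))
        fun u hu => (hb s u hs hu.1 hsx (hu.2.trans hTb)).2
      rw [intervalIntegral.integral_const, smul_eq_mul] at this
      nlinarith
  have houter : ∀ h : ℝ → ℝ → ℝ, Measurable (Function.uncurry h) →
      (∀ t T, 0 ≤ t → t ≤ T → t ≤ x → T ≤ b → 0 ≤ h t T ∧ h t T ≤ C) →
      ∀ t T, 0 ≤ t → t ≤ T → t ≤ x → T ≤ b →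
        IntervalIntegrable (fun s => R (∫ u in s..T, h s u)) volume 0 t ∧
        (∫ s in (0 : ℝ)..t, R (∫ u in s..T, h s u)) ≤ K * b := by
    intro h hm hb t T ht htT htx hTb
    have hbd : ∀ s, 0 ≤ s → s ≤ t → |R (∫ u in s..T, h s u)| ≤ K := fun s hs hst => by
      have := hval h hm hb s T hs (hst.trans htT) (hst.trans htx) hTb
      exact hRK _ this.1 this.2
    have hi := intervalIntegrable_of_measurable_of_bound
      (hR.comp (measurable_intervalIntegral_left hm T)) ht hbd
    refine ⟨hi, ?_⟩
    have := intervalIntegral.integral_mono_on ht hi (intervalIntegrable_const (c := K))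
      fun s hs => (le_abs_self _).trans (hbd s hs.1 hs.2)
    rw [intervalIntegral.integral_const, smul_eq_mul] at this
    refine this.trans ?_
    nlinarith
  set A := Real.exp (K * b) * G * (L * b) with hA
  have hA0 : 0 ≤ A := by positivity
  -- Picard iteration.
  have hiter : ∀ n : ℕ, ∀ t T, 0 ≤ t → t ≤ T → t ≤ x → T ≤ b →
      |h₁ t T - h₂ t T| ≤ C * ((A * t) ^ n / n.factorial) := by
    intro n
    induction n with
    | zero =>
      intro t T ht htT htx hTb
      have h1 := hb₁ t T ht htT htx hTb
      have h2 := hb₂ t T ht htT htx hTb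
      simp only [pow_zero, Nat.factorial_zero, Nat.cast_one, div_one, mul_one]
      exact abs_le.2 ⟨by linarith, by linarith⟩
    | succ n ih =>
      intro t T ht htT htx hTb
      have hin : ∀ s, 0 ≤ s → s ≤ t →
          |(∫ u in s..T, h₁ s u) - ∫ u in s..T, h₂ s u| ≤
            b * (C * ((A * s) ^ n / n.factorial)) := by
        intro s hs hst
        have hsT := hst.trans htT
        have hsx := hst.trans htx
        rw [← intervalIntegral.integral_sub (hint h₁ h₁_meas hb₁ s T hs hsT hsx hTb)
          (hint h₂ h₂_meas hb₂ s T hs hsT hsx hTb)]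
        have := intervalIntegral.norm_integral_le_of_norm_le_const (a := s) (b := T)
          (f := fun u => h₁ s u - h₂ s u) (C := C * ((A * s) ^ n / n.factorial)) (by
            intro u hu
            rw [uIoc_of_le hsT] at hu
            exact ih s u hs hu.1.le hsx (hu.2.trans hTb))
        rw [Real.norm_eq_abs, abs_of_nonneg (sub_nonneg.2 hsT)] at this
        refine this.trans ?_
        rw [mul_comm]
        gcongr
        linarith
      obtain ⟨hi₁, hK₁⟩ := houter h₁ h₁_meas hb₁ t T ht htT htx hTb
      obtain ⟨hi₂, hK₂⟩ := houter h₂ h₂_meas hb₂ t T ht htT htx hTb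
      have hout : |(∫ s in (0 : ℝ)..t, R (∫ u in s..T, h₁ s u)) -
          ∫ s in (0 : ℝ)..t, R (∫ u in s..T, h₂ s u)| ≤
          L * b * C * A ^ n / n.factorial * (t ^ (n + 1) / (n + 1)) := by
        rw [← intervalIntegral.integral_sub hi₁ hi₂]
        have := intervalIntegral.norm_integral_le_of_norm_le (μ := volume) ht
          (f := fun s => R (∫ u in s..T, h₁ s u) - R (∫ u in s..T, h₂ s u))
          (g := fun s => L * b * C * A ^ n / n.factorial * s ^ n) (by
            refine Filter.Eventually.of_forall fun s hs => ?_
            have h1 := hval h₁ h₁_meas hb₁ s T hs.1.le (hs.2.trans htT) (hs.2.trans htx) hTb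
            have h2 := hval h₂ h₂_meas hb₂ s T hs.1.le (hs.2.trans htT) (hs.2.trans htx) hTb
            refine (hRL _ _ h1.1 h1.2 h2.1 h2.2).trans
              ((mul_le_mul_of_nonneg_left (hin s hs.1.le hs.2) hL).trans_eq ?_)
            rw [mul_pow]
            ring)
          (Continuous.intervalIntegrable (by fun_prop) _ _)
        rw [intervalIntegral.integral_const_mul, integral_pow] at this
        simpa using this
      obtain ⟨hg0, hgG⟩ := hg t T ht htT htx hTb
      rw [heq₁ t T ht htT htx hTb, heq₂ t T ht htT htx hTb, ← sub_mul, abs_mul,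
        abs_of_nonneg hg0]
      calc _ ≤ Real.exp (K * b) *
            (L * b * C * A ^ n / n.factorial * (t ^ (n + 1) / (n + 1))) * G := by
            refine mul_le_mul ((abs_exp_sub_exp_le hK₁ hK₂).trans ?_) hgG hg0 (by positivity)
            gcongr
        _ = C * ((A * t) ^ (n + 1) / (n + 1).factorial) := by
            rw [Nat.factorial_succ, mul_pow A t, Nat.cast_mul, Nat.cast_succ, hA]
            field_simp
            ring
  have hlim : Filter.Tendsto (fun n : ℕ => C * ((A * t) ^ n / n.factorial)) Filter.atTop
      (nhds 0) := by
    simpa using (FloorSemiring.tendsto_pow_div_factorial_atTop (A * t)).const_mul C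
  have h0 : |h₁ t T - h₂ t T| ≤ 0 :=
    ge_of_tendsto' hlim fun n => hiter n t T ht htT htx hTb
  exact sub_eq_zero.1 (abs_nonpos_iff.1 h0)

/-- uniqueness of bounded nonnegative solutions of the integral
equation `h(t,T) = exp(∫₀ᵗ R_{α,γ}(∫ₛᵀ h(s,u) du) ds)·g(t,T)` on the region
`𝒯_{x,y−δ}`, where `R_{α,γ}(z) = α·(log(γ(z+e²)))³`. -/
theorem stmt10 (Tstar : ℝ) (hTstar : 0 < Tstar)
    (α γ x y δ : ℝ) (hα : 0 < α) (hγ : 1 ≤ γ) (hαγ : 2 < α * γ) (hγT : 1 < γ * Tstar)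
    (hx : 0 < x) (hxy : x < y) (hy : y < min (α / 2) Tstar) (hgap : 1 < γ * (y - x))
    (hδ : 0 < δ) (hδy : δ < y)
    (g : ℝ → ℝ → ℝ) (hg_meas : Measurable (Function.uncurry g))
    (hg_nonneg : ∀ t T, 0 ≤ t → t ≤ T → T ≤ Tstar → t ≤ x → T ≤ y - δ → 0 ≤ g t T)
    (Cg : ℝ) (hg_bdd : ∀ t T, 0 ≤ t → t ≤ T → T ≤ Tstar → t ≤ x → T ≤ y - δ → g t T ≤ Cg)
    (h₁ h₂ : ℝ → ℝ → ℝ)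
    (h₁_meas : Measurable (Function.uncurry h₁)) (h₂_meas : Measurable (Function.uncurry h₂))
    (h₁_nonneg : ∀ t T, 0 ≤ t → t ≤ T → T ≤ Tstar → t ≤ x → T ≤ y - δ → 0 ≤ h₁ t T)
    (h₂_nonneg : ∀ t T, 0 ≤ t → t ≤ T → T ≤ Tstar → t ≤ x → T ≤ y - δ → 0 ≤ h₂ t T)
    (C₁ : ℝ) (h₁_bdd : ∀ t T, 0 ≤ t → t ≤ T → T ≤ Tstar → t ≤ x → T ≤ y - δ → h₁ t T ≤ C₁)
    (C₂ : ℝ) (h₂_bdd : ∀ t T, 0 ≤ t → t ≤ T → T ≤ Tstar → t ≤ x → T ≤ y - δ → h₂ t T ≤ C₂)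
    (heq₁ : ∀ t T, 0 ≤ t → t ≤ T → T ≤ Tstar → t ≤ x → T ≤ y - δ →
      h₁ t T = Real.exp (∫ s in (0 : ℝ)..t,
        α * Real.log (γ * ((∫ u in s..T, h₁ s u) + Real.exp 2)) ^ 3) * g t T)
    (heq₂ : ∀ t T, 0 ≤ t → t ≤ T → T ≤ Tstar → t ≤ x → T ≤ y - δ →
      h₂ t T = Real.exp (∫ s in (0 : ℝ)..t,
        α * Real.log (γ * ((∫ u in s..T, h₂ s u) + Real.exp 2)) ^ 3) * g t T) :
    ∀ t T, 0 ≤ t → t ≤ T → T ≤ Tstar → t ≤ x → T ≤ y - δ → h₁ t T = h₂ t T := by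
  have hyT : y < Tstar := hy.trans_le (min_le_right _ _)
  have hTs : ∀ {T : ℝ}, T ≤ y - δ → T ≤ Tstar := fun h => by linarith
  have hb0 : 0 ≤ y - δ := by linarith
  set C := max (max C₁ C₂) 0
  have hC₁ : C₁ ≤ C := (le_max_left _ _).trans (le_max_left _ _)
  have hC₂ : C₂ ≤ C := (le_max_right _ _).trans (le_max_left _ _)
  have hC : 0 ≤ C := le_max_right _ _
  intro t T ht htT _ htx hTb
  refine eq_of_exp_integral_eq (R := fun z => α * Real.log (γ * (z + Real.exp 2)) ^ 3)
    (by fun_prop) (C := C) (G := Cg) (x := x) (b := y - δ)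
    (K := α * Real.log (γ * (C * (y - δ) + Real.exp 2)) ^ 3)
    (L := α * (3 * Real.log (γ * (C * (y - δ) + Real.exp 2)) ^ 2))
    ?_ (fun z w hz hzM hw hwM => abs_logCube_sub_le hα hγ hz hzM hw hwM) hC (by positivity)
    (g := g)
    (fun t T h1 h2 h3 h4 =>
      ⟨hg_nonneg t T h1 h2 (hTs h4) h3 h4, hg_bdd t T h1 h2 (hTs h4) h3 h4⟩)
    h₁_meas h₂_meas
    (fun t T h1 h2 h3 h4 =>
      ⟨h₁_nonneg t T h1 h2 (hTs h4) h3 h4, (h₁_bdd t T h1 h2 (hTs h4) h3 h4).trans hC₁⟩)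
    (fun t T h1 h2 h3 h4 =>
      ⟨h₂_nonneg t T h1 h2 (hTs h4) h3 h4, (h₂_bdd t T h1 h2 (hTs h4) h3 h4).trans hC₂⟩)
    (fun t T h1 h2 h3 h4 => heq₁ t T h1 h2 (hTs h4) h3 h4)
    (fun t T h1 h2 h3 h4 => heq₂ t T h1 h2 (hTs h4) h3 h4) t T ht htT htx hTb
  intro z hz hzM
  have hlog := log_mul_add_exp_two_nonneg hγ hz
  rw [abs_of_nonneg (by positivity)]
  gcongr
end

section
/- Fix T* > 0 and set 𝒯 := {(t,T) ∈ ℝ² : 0 ≤ t ≤ T ≤ T*}. Let λ̲, λ̄ with 0 < λ̲ ≤ λ̄ < ∞, let λ : 𝒯 → ℝ be measurable with λ̲ ≤ λ(t,T) ≤ λ̄ for all (t,T) ∈ 𝒯, and let a : 𝒯 → (0, ∞) be measurable with K := sup_{(t,T)∈𝒯} a(t,T) < ∞. Let J′ : [0, ∞) → ℝ be monotone increasing and satisfy limsup_{z→∞} (log z − λ̄·T*·J′(z)) = +∞. Then there exists a constant c > 0 such that for every measurable h : 𝒯 → ℝ with 0 ≤ h(t,T) ≤ c for all (t,T) ∈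 𝒯, the function (𝒜h)(t,T) := a(t,T)·exp(∫₀ᵗ J′(∫ₛᵀ λ(s,u) h(s,u) du) λ(s,T) ds) also satisfies (𝒜h)(t,T) ≤ c for all (t,T) ∈ 𝒯. -/
open MeasureTheory Set intervalIntegral

/-- An upper bound on an interval integral that needs no integrability: a nonintegrable function has
integral zero, which a nonnegative bound dominates. -/
theorem intervalIntegral_le_mul_of_le {f : ℝ → ℝ} {a b B : ℝ} (hab : a ≤ b) (hB : 0 ≤ B)
    (hf : ∀ x ∈ Icc a b, f x ≤ B) : ∫ x in a..b, f x ≤ B * (b - a) := by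
  by_cases hi : IntervalIntegrable f volume a b
  · calc ∫ x in a..b, f x ≤ ∫ _ in a..b, B :=
          intervalIntegral.integral_mono_on hab hi intervalIntegrable_const hf
      _ = B * (b - a) := by simp [mul_comm]
  · rw [intervalIntegral.integral_undef hi]
    exact mul_nonneg hB (sub_nonneg.2 hab)

/-- under the growth condition
`limsup_{z→∞}(log z − λ̄T*J′(z)) = +∞`, there is a constant `c > 0` such that
the HJM operator `𝒜` maps the set of nonnegative measurable fields bounded by
`c` on the triangle `𝒯` into itself. -/
theorem stmt12 (Tstar : ℝ) (hTstar : 0 < Tstar)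
    (lamL lamU : ℝ) (hlamL : 0 < lamL) (hlamLU : lamL ≤ lamU)
    (lam : ℝ → ℝ → ℝ) (hlam_meas : Measurable (Function.uncurry lam))
    (hlam_bdd : ∀ t T, 0 ≤ t → t ≤ T → T ≤ Tstar → lamL ≤ lam t T ∧ lam t T ≤ lamU)
    (a : ℝ → ℝ → ℝ) (ha_meas : Measurable (Function.uncurry a))
    (ha_pos : ∀ t T, 0 ≤ t → t ≤ T → T ≤ Tstar → 0 < a t T)
    (K : ℝ) (ha_bdd : ∀ t T, 0 ≤ t → t ≤ T → T ≤ Tstar → a t T ≤ K)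
    (J' : ℝ → ℝ) (hJmono : MonotoneOn J' (Ici 0))
    (hlimsup : ∀ M : ℝ, ∀ z₀ : ℝ, ∃ z ≥ z₀, M ≤ Real.log z - lamU * Tstar * J' z) :
    ∃ c > (0 : ℝ), ∀ h : ℝ → ℝ → ℝ, Measurable (Function.uncurry h) →
      (∀ t T, 0 ≤ t → t ≤ T → T ≤ Tstar → 0 ≤ h t T ∧ h t T ≤ c) →
      ∀ t T, 0 ≤ t → t ≤ T → T ≤ Tstar →
        a t T * Real.exp (∫ s in (0 : ℝ)..t,
          J' (∫ u in s..T, lam s u * h s u) * lam s T) ≤ c := by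
  have hU : 0 < lamU := hlamL.trans_le hlamLU
  have hUT : 0 < lamU * Tstar := mul_pos hU hTstar
  have hK : 0 < K :=
    (ha_pos 0 0 le_rfl le_rfl hTstar.le).trans_le (ha_bdd 0 0 le_rfl le_rfl hTstar.le)
  obtain ⟨z, hz, hlog⟩ :=
    hlimsup (Real.log K + Real.log (lamU * Tstar)) (lamU * Tstar * K)
  have hz0 : 0 < z := (mul_pos hUT hK).trans_le hz
  have hc : 0 < z / (lamU * Tstar) := div_pos hz0 hUT
  have hKc : K * Real.exp (max (J' z) 0 * lamU * Tstar) ≤ z / (lamU * Tstar) := by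
    rcases le_total (J' z) 0 with hJ | hJ
    · rw [max_eq_right hJ, le_div_iff₀ hUT]
      simpa [mul_comm] using hz
    · rw [max_eq_left hJ, ← Real.log_le_log_iff (by positivity) hc,
        Real.log_mul hK.ne' (Real.exp_ne_zero _), Real.log_exp,
        Real.log_div hz0.ne' hUT.ne']
      linarith
  refine ⟨z / (lamU * Tstar), hc, fun h _ hh t T ht htT hT => ?_⟩
  have hB : 0 ≤ max (J' z) 0 := le_max_right _ _
  have hexp : ∫ s in (0 : ℝ)..t, J' (∫ u in s..T, lam s u * h s u) * lam s T ≤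
      max (J' z) 0 * lamU * Tstar := by
    refine (intervalIntegral_le_mul_of_le ht (mul_nonneg hB hU.le) fun s hs => ?_).trans
      (mul_le_mul_of_nonneg_left (by linarith) (mul_nonneg hB hU.le))
    have hsT : s ≤ T := hs.2.trans htT
    obtain ⟨hl, hu⟩ := hlam_bdd s T hs.1 hsT hT
    have hin0 : 0 ≤ ∫ u in s..T, lam s u * h s u :=
      intervalIntegral.integral_nonneg hsT fun u hu =>
        mul_nonneg (hlamL.le.trans (hlam_bdd s u hs.1 hu.1 (hu.2.trans hT)).1)
          (hh s u hs.1 hu.1 (hu.2.trans hT)).1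
    have hinz : ∫ u in s..T, lam s u * h s u ≤ z := by
      calc ∫ u in s..T, lam s u * h s u ≤ lamU * (z / (lamU * Tstar)) * (T - s) :=
            intervalIntegral_le_mul_of_le hsT (mul_pos hU hc).le fun u hu =>
              mul_le_mul (hlam_bdd s u hs.1 hu.1 (hu.2.trans hT)).2
                (hh s u hs.1 hu.1 (hu.2.trans hT)).2
                (hh s u hs.1 hu.1 (hu.2.trans hT)).1 hU.le
        _ ≤ lamU * (z / (lamU * Tstar)) * Tstar :=
            mul_le_mul_of_nonneg_left (by linarith [hs.1]) (mul_pos hU hc).le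
        _ = z := by field_simp
    exact mul_le_mul ((hJmono hin0 hz0.le hinz).trans (le_max_left _ _)) hu
      (hlamL.le.trans hl) hB
  exact (mul_le_mul (ha_bdd t T ht htT hT) (Real.exp_le_exp.2 hexp)
    (Real.exp_pos _).le hK.le).trans hKc
end

section
/- Fix T* > 0 and set 𝒯 := {(t,T) ∈ ℝ² : 0 ≤ t ≤ T ≤ T*}. Let λ̲, λ̄ with 0 < λ̲ ≤ λ̄ < ∞, let λ : 𝒯 → ℝ be continuous with λ̲ ≤ λ(t,T) ≤ λ̄ for all (t,T) ∈ 𝒯, and let a : 𝒯 → (0, ∞) be measurable and bounded. Let J′ : [0, ∞) → ℝ be continuous, monotone increasing, and satisfy limsup_{z→∞} (log z − λ̄·T*·J′(z)) = +∞. Then there exists a bounded measurable function f : 𝒯 → [0, ∞) satisfying f(t,T) = a(t,T)·exp(∫₀ᵗ J′(∫ₛᵀ λ(s,u) f(s,u) du) λ(s,T) ds) for all (t,T) ∈ 𝒯. -/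
open MeasureTheory Set intervalIntegral

/-- The inner integral `∫ₛᵀ l(s,u) f(s,u) du` as a function of `(s, T)`. -/
noncomputable def innerIntegral (l f : ℝ → ℝ → ℝ) (s T : ℝ) : ℝ :=
  ∫ u in Ioc s T, l s u * f s u

/-- The right-hand side of the fixed-point equation as an operator acting on `f`. -/
noncomputable def hjmOperator (A l : ℝ → ℝ → ℝ) (j : ℝ → ℝ) (f : ℝ → ℝ → ℝ) (t T : ℝ) : ℝ :=
  A t T * Real.exp (∫ s in Ioc 0 t, j (innerIntegral l f s T) * l s T)

/-- Jointly measurable functions with values in `[0, C]`. -/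
def IsMeasurableBetween (C : ℝ) (f : ℝ → ℝ → ℝ) : Prop :=
  Measurable (Function.uncurry f) ∧ ∀ t T, 0 ≤ f t T ∧ f t T ≤ C

theorem measurable_setIntegral_Ioc {α : Type*} [MeasurableSpace α] {g : α → ℝ → ℝ}
    (hg : Measurable (Function.uncurry g)) {b c : α → ℝ} (hb : Measurable b) (hc : Measurable c) :
    Measurable fun x => ∫ u in Ioc (b x) (c x), g x u := by
  have hS : MeasurableSet {p : α × ℝ | b p.1 < p.2 ∧ p.2 ≤ c p.1} :=
    (measurableSet_lt (hb.comp measurable_fst) measurable_snd).inter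
      (measurableSet_le measurable_snd (hc.comp measurable_fst))
  have h := ((hg.indicator hS).stronglyMeasurable.integral_prod_right' (ν := volume)).measurable
  convert h using 2 with x
  rw [← MeasureTheory.integral_indicator measurableSet_Ioc]
  rfl

theorem integrableOn_Ioc_of_bounded {g : ℝ → ℝ} (hg : Measurable g) {b c B : ℝ}
    (hB : ∀ u ∈ Ioc b c, |g u| ≤ B) : IntegrableOn g (Ioc b c) :=
  Measure.integrableOn_of_bounded (M := B) measure_Ioc_lt_top.ne hg.aestronglyMeasurable
    ((ae_restrict_iff' measurableSet_Ioc).2 (.of_forall hB))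

theorem setIntegral_Ioc_le_of_le_const {g : ℝ → ℝ} {b c B : ℝ} (hbc : b ≤ c)
    (hg : IntegrableOn g (Ioc b c)) (hB : ∀ u ∈ Ioc b c, g u ≤ B) :
    ∫ u in Ioc b c, g u ≤ B * (c - b) := by
  have h := setIntegral_mono_on hg (integrableOn_const (C := B) measure_Ioc_lt_top.ne)
    measurableSet_Ioc hB
  simpa [Measure.real, hbc, mul_comm] using h

section Operator

variable {A l : ℝ → ℝ → ℝ} {j : ℝ → ℝ} {f g : ℝ → ℝ → ℝ} {C K L S : ℝ}

theorem measurable_uncurry_innerIntegral (hl : Measurable (Function.uncurry l))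
    (hf : Measurable (Function.uncurry f)) :
    Measurable (Function.uncurry (innerIntegral l f)) := by
  have h : Measurable (Function.uncurry fun (p : ℝ × ℝ) (u : ℝ) => l p.1 u * f p.1 u) := by
    have hm : Measurable fun q : (ℝ × ℝ) × ℝ => (q.1.1, q.2) := by fun_prop
    exact (hl.comp hm).mul (hf.comp hm)
  exact measurable_setIntegral_Ioc h measurable_fst measurable_snd

theorem measurable_uncurry_hjmOperator (hA : Measurable (Function.uncurry A))
    (hl : Measurable (Function.uncurry l)) (hj : Continuous j)
    (hf : Measurable (Function.uncurry f)) :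
    Measurable (Function.uncurry (hjmOperator A l j f)) := by
  have h : Measurable (Function.uncurry fun (p : ℝ × ℝ) (s : ℝ) =>
      j (innerIntegral l f s p.2) * l s p.2) := by
    have hm : Measurable fun q : (ℝ × ℝ) × ℝ => (q.2, q.1.2) := by fun_prop
    exact (hj.measurable.comp ((measurable_uncurry_innerIntegral hl hf).comp hm)).mul (hl.comp hm)
  exact hA.mul (Real.measurable_exp.comp
    (measurable_setIntegral_Ioc h measurable_const measurable_fst))

theorem abs_mul_le_of_between (hl : IsMeasurableBetween L l) (hf : IsMeasurableBetween C f)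
    (s u : ℝ) : |l s u * f s u| ≤ L * C := by
  rw [abs_of_nonneg (mul_nonneg (hl.2 s u).1 (hf.2 s u).1)]
  exact mul_le_mul (hl.2 s u).2 (hf.2 s u).2 (hf.2 s u).1 ((hl.2 s u).1.trans (hl.2 s u).2)

theorem measurable_mul_section (hl : IsMeasurableBetween L l) (hf : IsMeasurableBetween C f)
    (s : ℝ) : Measurable fun u => l s u * f s u :=
  (hl.1.comp measurable_prodMk_left).mul (hf.1.comp measurable_prodMk_left)

theorem integrableOn_mul_section (hl : IsMeasurableBetween L l) (hf : IsMeasurableBetween C f)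
    (s T : ℝ) : IntegrableOn (fun u => l s u * f s u) (Ioc s T) :=
  integrableOn_Ioc_of_bounded (measurable_mul_section hl hf s)
    fun u _ => abs_mul_le_of_between hl hf s u

theorem innerIntegral_nonneg (hl : IsMeasurableBetween L l) (hf : IsMeasurableBetween C f)
    (s T : ℝ) : 0 ≤ innerIntegral l f s T :=
  integral_nonneg fun u => mul_nonneg (hl.2 s u).1 (hf.2 s u).1

theorem innerIntegral_le (hl : IsMeasurableBetween L l) (hf : IsMeasurableBetween C f)
    {s T : ℝ} (hs : 0 ≤ s) (hsT : s ≤ T) (hTS : T ≤ S) :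
    innerIntegral l f s T ≤ L * S * C := by
  have h := setIntegral_Ioc_le_of_le_const hsT (integrableOn_mul_section hl hf s T)
    fun u _ => (le_abs_self _).trans (abs_mul_le_of_between hl hf s u)
  have h0 : 0 ≤ L * C := (abs_nonneg _).trans (abs_mul_le_of_between hl hf 0 0)
  calc innerIntegral l f s T ≤ L * C * (T - s) := h
    _ ≤ L * C * S := by gcongr; linarith
    _ = L * S * C := by ring

theorem innerIntegral_mono (hl : IsMeasurableBetween L l) (hf : IsMeasurableBetween C f)
    (hg : IsMeasurableBetween C g) (hfg : f ≤ g) (s T : ℝ) :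
    innerIntegral l f s T ≤ innerIntegral l g s T :=
  integral_mono (integrableOn_mul_section hl hf s T) (integrableOn_mul_section hl hg s T)
    fun u => mul_le_mul_of_nonneg_left (hfg s u) (hl.2 s u).1

theorem abs_outer_integrand_le (hl : IsMeasurableBetween L l) (hj : Monotone j)
    (hf : IsMeasurableBetween C f) {s t T : ℝ} (htT : t ≤ T) (hTS : T ≤ S) (hs : s ∈ Ioc 0 t) :
    |j (innerIntegral l f s T) * l s T| ≤ max |j 0| |j (L * S * C)| * L := by
  rw [abs_mul, abs_of_nonneg (hl.2 s T).1]
  exact mul_le_mul (abs_le_max_abs_abs (hj (innerIntegral_nonneg hl hf s T))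
    (hj (innerIntegral_le hl hf hs.1.le (hs.2.trans htT) hTS))) (hl.2 s T).2 (hl.2 s T).1
    (le_max_of_le_left (abs_nonneg _))

theorem measurable_outer_integrand (hl : IsMeasurableBetween L l) (hj : Continuous j)
    (hf : IsMeasurableBetween C f) (T : ℝ) :
    Measurable fun s => j (innerIntegral l f s T) * l s T :=
  (hj.measurable.comp ((measurable_uncurry_innerIntegral hl.1 hf.1).comp
    measurable_prodMk_right)).mul (hl.1.comp measurable_prodMk_right)

theorem integrableOn_outer_integrand (hl : IsMeasurableBetween L l) (hj : Continuous j)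
    (hj' : Monotone j) (hf : IsMeasurableBetween C f) {t T : ℝ} (htT : t ≤ T) (hTS : T ≤ S) :
    IntegrableOn (fun s => j (innerIntegral l f s T) * l s T) (Ioc 0 t) :=
  integrableOn_Ioc_of_bounded (measurable_outer_integrand hl hj hf T)
    fun _ hs => abs_outer_integrand_le hl hj' hf htT hTS hs

theorem hjmOperator_between (hA : IsMeasurableBetween K A)
    (hAsupp : ∀ t T, A t T ≠ 0 → 0 ≤ t ∧ t ≤ T ∧ T ≤ S)
    (hl : IsMeasurableBetween L l) (hj : Continuous j) (hj' : Monotone j) (hC : 0 ≤ C)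
    (hKC : K * Real.exp (max 0 (j (L * S * C)) * L * S) ≤ C) (hf : IsMeasurableBetween C f) :
    IsMeasurableBetween C (hjmOperator A l j f) := by
  refine ⟨measurable_uncurry_hjmOperator hA.1 hl.1 hj hf.1, fun t T =>
    ⟨mul_nonneg (hA.2 t T).1 (Real.exp_pos _).le, ?_⟩⟩
  by_cases h0 : A t T = 0
  · simpa [hjmOperator, h0] using hC
  obtain ⟨ht, htT, hTS⟩ := hAsupp t T h0
  have hL : 0 ≤ L := (hl.2 0 0).1.trans (hl.2 0 0).2
  have hbound : ∫ s in Ioc 0 t, j (innerIntegral l f s T) * l s T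
      ≤ max 0 (j (L * S * C)) * L * (t - 0) := by
    refine setIntegral_Ioc_le_of_le_const ht
      (integrableOn_outer_integrand hl hj hj' hf htT hTS) fun s hs => ?_
    exact mul_le_mul ((hj' (innerIntegral_le hl hf hs.1.le (hs.2.trans htT) hTS)).trans
      (le_max_right _ _)) (hl.2 s T).2 (hl.2 s T).1 (le_max_left _ _)
  refine le_trans ?_ hKC
  refine mul_le_mul (hA.2 t T).2 (Real.exp_le_exp.2 (hbound.trans ?_)) (Real.exp_pos _).le
    ((hA.2 t T).1.trans (hA.2 t T).2)
  exact mul_le_mul_of_nonneg_left (by linarith) (mul_nonneg (le_max_left _ _) hL)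

theorem hjmOperator_mono (hA : IsMeasurableBetween K A)
    (hAsupp : ∀ t T, A t T ≠ 0 → 0 ≤ t ∧ t ≤ T ∧ T ≤ S)
    (hl : IsMeasurableBetween L l) (hj : Continuous j) (hj' : Monotone j)
    (hf : IsMeasurableBetween C f) (hg : IsMeasurableBetween C g) (hfg : f ≤ g) :
    hjmOperator A l j f ≤ hjmOperator A l j g := by
  intro t T
  by_cases h0 : A t T = 0
  · simp [hjmOperator, h0]
  obtain ⟨ht, htT, hTS⟩ := hAsupp t T h0
  refine mul_le_mul_of_nonneg_left (Real.exp_le_exp.2 ?_) (hA.2 t T).1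
  exact integral_mono (integrableOn_outer_integrand hl hj hj' hf htT hTS)
    (integrableOn_outer_integrand hl hj hj' hg htT hTS) fun s =>
      mul_le_mul_of_nonneg_right (hj' (innerIntegral_mono hl hf hg hfg s T)) (hl.2 s T).1

open Filter Topology in
theorem tendsto_innerIntegral (hl : IsMeasurableBetween L l) {F : ℕ → ℝ → ℝ → ℝ}
    (hF : ∀ n, IsMeasurableBetween C (F n))
    (hlim : ∀ t T, Tendsto (fun n => F n t T) atTop (𝓝 (f t T))) (s T : ℝ) :
    Tendsto (fun n => innerIntegral l (F n) s T) atTop (𝓝 (innerIntegral l f s T)) :=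
  tendsto_integral_of_dominated_convergence (fun _ => L * C)
    (fun n => (measurable_mul_section hl (hF n) s).aestronglyMeasurable)
    (integrableOn_const measure_Ioc_lt_top.ne)
    (fun n => .of_forall fun u => abs_mul_le_of_between hl (hF n) s u)
    (.of_forall fun u => (hlim s u).const_mul _)

open Filter Topology in
theorem tendsto_hjmOperator (hAsupp : ∀ t T, A t T ≠ 0 → 0 ≤ t ∧ t ≤ T ∧ T ≤ S)
    (hl : IsMeasurableBetween L l) (hj : Continuous j) (hj' : Monotone j)
    {F : ℕ → ℝ → ℝ → ℝ} (hF : ∀ n, IsMeasurableBetween C (F n))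
    (hlim : ∀ t T, Tendsto (fun n => F n t T) atTop (𝓝 (f t T))) (t T : ℝ) :
    Tendsto (fun n => hjmOperator A l j (F n) t T) atTop (𝓝 (hjmOperator A l j f t T)) := by
  by_cases h0 : A t T = 0
  · simp [hjmOperator, h0]
  obtain ⟨ht, htT, hTS⟩ := hAsupp t T h0
  refine ((Real.continuous_exp.tendsto _).comp ?_).const_mul _
  exact tendsto_integral_of_dominated_convergence (fun _ => max |j 0| |j (L * S * C)| * L)
    (fun n => (measurable_outer_integrand hl hj (hF n) T).aestronglyMeasurable)
    (integrableOn_const measure_Ioc_lt_top.ne)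
    (fun n => (ae_restrict_iff' measurableSet_Ioc).2 (.of_forall fun s hs =>
      abs_outer_integrand_le hl hj' (hF n) htT hTS hs))
    (.of_forall fun s =>
      ((hj.tendsto _).comp (tendsto_innerIntegral hl hF hlim s T)).mul_const _)

open Filter Topology in
/-- Monotone iteration from `0` yields a fixed point of `hjmOperator` with values in `[0, C]`. -/
theorem exists_hjmOperator_fixed_point (hA : IsMeasurableBetween K A)
    (hAsupp : ∀ t T, A t T ≠ 0 → 0 ≤ t ∧ t ≤ T ∧ T ≤ S)
    (hl : IsMeasurableBetween L l) (hj : Continuous j) (hj' : Monotone j) (hC : 0 ≤ C)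
    (hKC : K * Real.exp (max 0 (j (L * S * C)) * L * S) ≤ C) :
    ∃ f, IsMeasurableBetween C f ∧ hjmOperator A l j f = f := by
  set F : ℕ → ℝ → ℝ → ℝ := fun n => (hjmOperator A l j)^[n] 0 with hFdef
  have hsucc : ∀ n, F (n + 1) = hjmOperator A l j (F n) := fun n =>
    Function.iterate_succ_apply' _ _ _
  have hF : ∀ n, IsMeasurableBetween C (F n) := by
    intro n
    induction n with
    | zero => exact ⟨measurable_const, fun _ _ => ⟨le_rfl, hC⟩⟩
    | succ n ih =>
      rw [hsucc]
      exact hjmOperator_between hA hAsupp hl hj hj' hC hKC ih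
  have hstep : ∀ n, F n ≤ F (n + 1) := by
    intro n
    induction n with
    | zero => exact fun t T => ((hF 1).2 t T).1
    | succ n ih =>
      rw [hsucc n, hsucc (n + 1)]
      exact hjmOperator_mono hA hAsupp hl hj hj' (hF n) (hF (n + 1)) ih
  have hmono : Monotone F := monotone_nat_of_le_succ hstep
  have hlim : ∀ t T, Tendsto (fun n => F n t T) atTop (𝓝 (⨆ n, F n t T)) := fun t T =>
    tendsto_atTop_ciSup (fun _ _ h => hmono h t T)
      ⟨C, forall_mem_range.2 fun n => ((hF n).2 t T).2⟩
  refine ⟨fun t T => ⨆ n, F n t T, ⟨?_, fun t T => ⟨?_, ?_⟩⟩, ?_⟩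
  · exact measurable_of_tendsto_metrizable (fun n => (hF n).1)
      (tendsto_pi_nhds.2 fun p => hlim p.1 p.2)
  · exact ge_of_tendsto' (hlim t T) fun n => ((hF n).2 t T).1
  · exact le_of_tendsto' (hlim t T) fun n => ((hF n).2 t T).2
  · funext t T
    refine tendsto_nhds_unique (tendsto_hjmOperator hAsupp hl hj hj' hF hlim t T) ?_
    simpa only [hsucc] using (tendsto_add_atTop_iff_nat 1).2 (hlim t T)

end Operator

/-- The growth condition supplies an upper bound preserved by `hjmOperator`. -/
theorem exists_mul_exp_le {J : ℝ → ℝ} {K L S : ℝ} (hK : 0 < K) (hL : 0 < L) (hS : 0 < S)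
    (h : ∀ M : ℝ, ∀ z₀ : ℝ, ∃ z ≥ z₀, M ≤ Real.log z - L * S * J z) :
    ∃ C, 0 ≤ C ∧ K * Real.exp (max 0 (J (L * S * C)) * L * S) ≤ C := by
  have hLS : 0 < L * S := mul_pos hL hS
  obtain ⟨z, hz, hM⟩ := h (Real.log (L * S * K)) (L * S * K)
  have hpos : 0 < L * S * K := mul_pos hLS hK
  have hzpos : 0 < z := hpos.trans_le hz
  refine ⟨z / (L * S), (div_pos hzpos hLS).le, ?_⟩
  rw [mul_div_cancel₀ _ hLS.ne', le_div_iff₀ hLS]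
  rcases le_total (J z) 0 with hJ | hJ
  · rw [max_eq_left hJ]
    simp only [zero_mul, Real.exp_zero]
    linarith
  · rw [max_eq_right hJ]
    calc K * Real.exp (J z * L * S) * (L * S)
        = Real.exp (Real.log (L * S * K) + L * S * J z) := by
          rw [Real.exp_add, Real.exp_log hpos]; ring_nf
      _ ≤ Real.exp (Real.log z) := Real.exp_le_exp.2 (by linarith)
      _ = z := Real.exp_log hzpos

/-- the deterministic core of the existence theorem: under the
growth condition `limsup_{z→∞}(log z − λ̄T*J′(z)) = +∞` there exists a bounded
nonnegative measurable solution of the HJM fixed-point equation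
`f(t,T) = a(t,T)·exp(∫₀ᵗ J′(∫ₛᵀ λ(s,u)f(s,u) du) λ(s,T) ds)` on the triangle
`𝒯 = {(t,T) : 0 ≤ t ≤ T ≤ T*}`. -/
theorem stmt13 (Tstar : ℝ) (hTstar : 0 < Tstar)
    (lamL lamU : ℝ) (hlamL : 0 < lamL) (hlamLU : lamL ≤ lamU)
    (lam : ℝ → ℝ → ℝ)
    (hlam_cont : ContinuousOn (Function.uncurry lam)
      {p : ℝ × ℝ | 0 ≤ p.1 ∧ p.1 ≤ p.2 ∧ p.2 ≤ Tstar})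
    (hlam_bdd : ∀ t T, 0 ≤ t → t ≤ T → T ≤ Tstar → lamL ≤ lam t T ∧ lam t T ≤ lamU)
    (a : ℝ → ℝ → ℝ) (ha_meas : Measurable (Function.uncurry a))
    (ha_pos : ∀ t T, 0 ≤ t → t ≤ T → T ≤ Tstar → 0 < a t T)
    (K : ℝ) (ha_bdd : ∀ t T, 0 ≤ t → t ≤ T → T ≤ Tstar → a t T ≤ K)
    (J' : ℝ → ℝ) (hJcont : ContinuousOn J' (Ici 0)) (hJmono : MonotoneOn J' (Ici 0))
    (hlimsup : ∀ M : ℝ, ∀ z₀ : ℝ, ∃ z ≥ z₀, M ≤ Real.log z - lamU * Tstar * J' z) :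
    ∃ f : ℝ → ℝ → ℝ, Measurable (Function.uncurry f) ∧
      (∃ C : ℝ, ∀ t T, 0 ≤ t → t ≤ T → T ≤ Tstar → 0 ≤ f t T ∧ f t T ≤ C) ∧
      ∀ t T, 0 ≤ t → t ≤ T → T ≤ Tstar →
        f t T = a t T * Real.exp (∫ s in (0 : ℝ)..t,
          J' (∫ u in s..T, lam s u * f s u) * lam s T) := by
  set D : Set (ℝ × ℝ) := {p : ℝ × ℝ | 0 ≤ p.1 ∧ p.1 ≤ p.2 ∧ p.2 ≤ Tstar} with hD
  have hDclosed : IsClosed D :=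
    (isClosed_le continuous_const continuous_fst).inter
      ((isClosed_le continuous_fst continuous_snd).inter
        (isClosed_le continuous_snd continuous_const))
  have hDmeas : MeasurableSet D := hDclosed.measurableSet
  have hlamU : 0 < lamU := hlamL.trans_le hlamLU
  have hK : 0 < K :=
    (ha_pos 0 0 le_rfl le_rfl hTstar.le).trans_le (ha_bdd 0 0 le_rfl le_rfl hTstar.le)
  obtain ⟨C, hC, hKC⟩ := exists_mul_exp_le hK hlamU hTstar hlimsup
  let A : ℝ → ℝ → ℝ := fun t T => D.indicator (Function.uncurry a) (t, T)
  let l : ℝ → ℝ → ℝ := fun t T => D.indicator (Function.uncurry lam) (t, T)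
  let j : ℝ → ℝ := fun x => J' (max 0 x)
  have hAD : ∀ {t T}, 0 ≤ t → t ≤ T → T ≤ Tstar → A t T = a t T := fun h₁ h₂ h₃ =>
    indicator_of_mem (s := D) ⟨h₁, h₂, h₃⟩ _
  have hlD : ∀ {t T}, 0 ≤ t → t ≤ T → T ≤ Tstar → l t T = lam t T := fun h₁ h₂ h₃ =>
    indicator_of_mem (s := D) ⟨h₁, h₂, h₃⟩ _
  have hAsupp : ∀ t T, A t T ≠ 0 → 0 ≤ t ∧ t ≤ T ∧ T ≤ Tstar := fun t T h =>
    mem_of_indicator_ne_zero (s := D) (a := (t, T)) h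
  have hA : IsMeasurableBetween K A := by
    refine ⟨ha_meas.indicator hDmeas, fun t T => ?_⟩
    by_cases h : (t, T) ∈ D
    · rw [hAD h.1 h.2.1 h.2.2]
      exact ⟨(ha_pos t T h.1 h.2.1 h.2.2).le, ha_bdd t T h.1 h.2.1 h.2.2⟩
    · simpa only [A, indicator_of_notMem h] using ⟨le_rfl, hK.le⟩
  have hl : IsMeasurableBetween lamU l := by
    refine ⟨?_, fun t T => ?_⟩
    · classical
      have h : Measurable (D.piecewise (Function.uncurry lam) 0) :=
        hlam_cont.measurable_piecewise (continuousOn_const (c := (0 : ℝ))) hDmeas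
      rwa [piecewise_eq_indicator] at h
    · by_cases h : (t, T) ∈ D
      · rw [hlD h.1 h.2.1 h.2.2]
        have hb := hlam_bdd t T h.1 h.2.1 h.2.2
        exact ⟨hlamL.le.trans hb.1, hb.2⟩
      · simpa only [l, indicator_of_notMem h] using ⟨le_rfl, hlamU.le⟩
  have hj : Continuous j :=
    hJcont.comp_continuous (continuous_const.max continuous_id) fun x => le_max_left 0 x
  have hj' : Monotone j := fun x y hxy =>
    hJmono (le_max_left 0 x) (le_max_left 0 y) (max_le_max le_rfl hxy)
  have hjnn : ∀ {x : ℝ}, 0 ≤ x → j x = J' x := fun h => by simp only [j, max_eq_right h]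
  rw [← hjnn (mul_nonneg (mul_pos hlamU hTstar).le hC)] at hKC
  obtain ⟨f, hf, hfix⟩ := exists_hjmOperator_fixed_point hA hAsupp hl hj hj' hC hKC
  refine ⟨f, hf.1, ⟨C, fun t T _ _ _ => hf.2 t T⟩, fun t T ht htT hTS => ?_⟩
  conv_lhs => rw [← hfix]
  rw [hjmOperator, hAD ht htT hTS, integral_of_le ht]
  congr 2
  refine setIntegral_congr_fun measurableSet_Ioc fun s hs => ?_
  have hsT : s ≤ T := hs.2.trans htT
  have hinner : innerIntegral l f s T = ∫ u in s..T, lam s u * f s u := by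
    rw [integral_of_le hsT]
    refine setIntegral_congr_fun measurableSet_Ioc fun u hu => ?_
    simp only [hlD hs.1.le hu.1.le (hu.2.trans hTS)]
  simp only [hlD hs.1.le hsT hTS, ← hinner, hjnn (innerIntegral_nonneg hl hf s T)]
end

section
/- Fix T* > 0 and set 𝒯 := {(t,T) ∈ ℝ² : 0 ≤ t ≤ T ≤ T*}. Let λ̲, λ̄ with 0 < λ̲ ≤ λ̄ < ∞, let λ : 𝒯 → ℝ be measurable with λ̲ ≤ λ(t,T) ≤ λ̄ for all (t,T) ∈ 𝒯, let a : 𝒯 → (0, ∞) be measurable and bounded, and let J′ : [0, ∞) → ℝ be Lipschitz continuous and monotone increasing. If f₁, f₂ : 𝒯 → [0, ∞) are bounded measurable functions each satisfying fᵢ(t,T) = a(t,T)·exp(∫₀ᵗ J′(∫ₛᵀ λ(s,u) fᵢ(s,u) du) λ(s,T) ds) for all (t,T) ∈ 𝒯, then f₁ = f₂ on 𝒯. -/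
open MeasureTheory Set intervalIntegral

/-- Joint measurability makes `s ↦ ∫ u in (s, T], h s u` measurable. -/
theorem measurable_setIntegral_Ioc_left {h : ℝ → ℝ → ℝ}
    (hh : Measurable (Function.uncurry h)) (T : ℝ) :
    Measurable fun s => ∫ u in Ioc s T, h s u := by
  have hS : MeasurableSet {p : ℝ × ℝ | p.1 < p.2 ∧ p.2 ≤ T} :=
    (measurableSet_lt measurable_fst measurable_snd).inter
      (measurableSet_le measurable_snd measurable_const)
  have hm := (hh.indicator hS).stronglyMeasurable.integral_prod_right' (ν := volume)
  convert hm.measurable using 2 with s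
  rw [← MeasureTheory.integral_indicator measurableSet_Ioc]
  rfl

/-- A Borel function bounded on a half-open interval is interval integrable there. -/
theorem intervalIntegrable_of_measurable_of_bound_s14 {g : ℝ → ℝ} {x y B : ℝ} (hxy : x ≤ y)
    (hg : Measurable g) (hB : ∀ u ∈ Ioc x y, |g u| ≤ B) :
    IntervalIntegrable g volume x y := by
  rw [intervalIntegrable_iff_integrableOn_Ioc_of_le hxy]
  refine Measure.integrableOn_of_bounded (M := B) (by simp) hg.aestronglyMeasurable ?_
  filter_upwards [ae_restrict_mem measurableSet_Ioc] with u hu using hB u hu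

theorem abs_exp_sub_exp_le_s14 (x y : ℝ) :
    |Real.exp x - Real.exp y| ≤ (Real.exp x + Real.exp y) * |x - y| := by
  have one_sided (x y : ℝ) : Real.exp x - Real.exp y ≤ (Real.exp x + Real.exp y) * |x - y| := by
    have h₁ : Real.exp x - Real.exp y = Real.exp x * (1 - Real.exp (y - x)) := by
      rw [mul_sub, ← Real.exp_add]; simp
    have h₂ : 1 - Real.exp (y - x) ≤ |x - y| := by
      linarith [Real.add_one_le_exp (y - x), le_abs_self (x - y)]
    rw [h₁]
    calc _ ≤ Real.exp x * |x - y| := by gcongr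
      _ ≤ _ := by
        gcongr
        linarith [Real.exp_pos y]
  refine abs_le.2 ⟨?_, one_sided x y⟩
  have := one_sided y x
  rw [abs_sub_comm y x] at this
  linarith

/-- The drift integrand `J' (∫ u in s..T, lam s u * f s u) * lam s T` is integrable in `s`. -/
theorem intervalIntegrable_drift {lam f : ℝ → ℝ → ℝ} {J' : ℝ → ℝ} {L : NNReal}
    {lamU C t T : ℝ} (ht : 0 ≤ t) (htT : t ≤ T)
    (hlam : Measurable (Function.uncurry lam)) (hf : Measurable (Function.uncurry f))
    (hlam_nonneg : ∀ s u, 0 ≤ s → s ≤ u → u ≤ T → 0 ≤ lam s u)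
    (hlam_le : ∀ s u, 0 ≤ s → s ≤ u → u ≤ T → lam s u ≤ lamU)
    (hf_nonneg : ∀ s u, 0 ≤ s → s ≤ u → u ≤ T → 0 ≤ f s u)
    (hf_le : ∀ s u, 0 ≤ s → s ≤ u → u ≤ T → f s u ≤ C)
    (hJ : LipschitzOnWith L J' (Ici 0)) :
    IntervalIntegrable (fun s => J' (∫ u in s..T, lam s u * f s u) * lam s T) volume 0 t := by
  have hJm : Measurable fun x => J' (max x 0) :=
    (hJ.continuousOn.comp_continuous (by fun_prop) fun x => le_max_right x 0).measurable
  have hm : Measurable fun s => J' (max (∫ u in Ioc s T, lam s u * f s u) 0) * lam s T :=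
    (hJm.comp (measurable_setIntegral_Ioc_left (h := fun s u => lam s u * f s u)
      (hlam.mul hf) T)).mul hlam.of_uncurry_right
  have hT : 0 ≤ T := ht.trans htT
  have hU : 0 ≤ lamU := (hlam_nonneg 0 T le_rfl hT le_rfl).trans (hlam_le 0 T le_rfl hT le_rfl)
  have hC : 0 ≤ C := (hf_nonneg 0 T le_rfl hT le_rfl).trans (hf_le 0 T le_rfl hT le_rfl)
  have hpos (s : ℝ) (hs : s ∈ Ioc 0 t) : 0 ≤ ∫ u in s..T, lam s u * f s u :=
    integral_nonneg (hs.2.trans htT) fun u hu =>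
      mul_nonneg (hlam_nonneg s u hs.1.le hu.1 hu.2) (hf_nonneg s u hs.1.le hu.1 hu.2)
  have heq (s : ℝ) (hs : s ∈ Ioc 0 t) :
      J' (max (∫ u in Ioc s T, lam s u * f s u) 0) * lam s T =
        J' (∫ u in s..T, lam s u * f s u) * lam s T := by
    rw [← integral_of_le (hs.2.trans htT), max_eq_left (hpos s hs)]
  refine (intervalIntegrable_of_measurable_of_bound_s14
    (B := (|J' 0| + L * (lamU * C * T)) * lamU) ht hm fun s hs => ?_).congr fun s hs => ?_
  · rw [heq s hs, abs_mul]
    have hsT : s ≤ T := hs.2.trans htT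
    have hint : ∫ u in s..T, lam s u * f s u ≤ lamU * C * T := by
      have h := norm_integral_le_of_norm_le_const (a := s) (b := T)
        (f := fun u => lam s u * f s u) (C := lamU * C) fun u hu => by
          rw [uIoc_of_le hsT] at hu
          rw [Real.norm_eq_abs, abs_mul, abs_of_nonneg (hlam_nonneg s u hs.1.le hu.1.le hu.2),
            abs_of_nonneg (hf_nonneg s u hs.1.le hu.1.le hu.2)]
          exact mul_le_mul (hlam_le s u hs.1.le hu.1.le hu.2) (hf_le s u hs.1.le hu.1.le hu.2)
            (hf_nonneg s u hs.1.le hu.1.le hu.2) hU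
      rw [abs_of_nonneg (sub_nonneg.2 hsT)] at h
      refine (le_abs_self _).trans (h.trans ?_)
      gcongr
      linarith [hs.1]
    have hJb := hJ.dist_le_mul _ (hpos s hs) 0 (mem_Ici.2 le_rfl)
    rw [Real.dist_eq, Real.dist_eq, sub_zero, abs_of_nonneg (hpos s hs)] at hJb
    have hJb' : |J' (∫ u in s..T, lam s u * f s u)| ≤ |J' 0| + L * (lamU * C * T) := by
      have h₁ := abs_sub_abs_le_abs_sub (J' (∫ u in s..T, lam s u * f s u)) (J' 0)
      have h₂ := mul_le_mul_of_nonneg_left hint L.coe_nonneg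
      linarith
    rw [abs_of_nonneg (hlam_nonneg s T hs.1.le hsT le_rfl)]
    exact mul_le_mul hJb' (hlam_le s T hs.1.le hsT le_rfl)
      (hlam_nonneg s T hs.1.le hsT le_rfl) ((abs_nonneg _).trans hJb')
  · rw [uIoc_of_le ht] at hs
    exact heq s hs

/-- A bound `b s` on `|f₁ s u - f₂ s u|`, uniform in `u`, bounds the difference of the drifts. -/
theorem abs_integral_drift_sub_le {lam f₁ f₂ : ℝ → ℝ → ℝ} {J' b : ℝ → ℝ} {L : NNReal}
    {lamU C₁ C₂ t T : ℝ} (ht : 0 ≤ t) (htT : t ≤ T)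
    (hlam : Measurable (Function.uncurry lam))
    (hf₁ : Measurable (Function.uncurry f₁)) (hf₂ : Measurable (Function.uncurry f₂))
    (hlam_nonneg : ∀ s u, 0 ≤ s → s ≤ u → u ≤ T → 0 ≤ lam s u)
    (hlam_le : ∀ s u, 0 ≤ s → s ≤ u → u ≤ T → lam s u ≤ lamU)
    (hf₁_nonneg : ∀ s u, 0 ≤ s → s ≤ u → u ≤ T → 0 ≤ f₁ s u)
    (hf₁_le : ∀ s u, 0 ≤ s → s ≤ u → u ≤ T → f₁ s u ≤ C₁)
    (hf₂_nonneg : ∀ s u, 0 ≤ s → s ≤ u → u ≤ T → 0 ≤ f₂ s u)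
    (hf₂_le : ∀ s u, 0 ≤ s → s ≤ u → u ≤ T → f₂ s u ≤ C₂)
    (hJ : LipschitzOnWith L J' (Ici 0)) (hb : Continuous b)
    (hfb : ∀ s u, 0 ≤ s → s ≤ u → u ≤ T → |f₁ s u - f₂ s u| ≤ b s) :
    |(∫ s in (0 : ℝ)..t, J' (∫ u in s..T, lam s u * f₁ s u) * lam s T) -
        ∫ s in (0 : ℝ)..t, J' (∫ u in s..T, lam s u * f₂ s u) * lam s T| ≤
      ∫ s in (0 : ℝ)..t, L * (lamU * b s * T) * lamU := by
  have hT : 0 ≤ T := ht.trans htT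
  have hU : 0 ≤ lamU := (hlam_nonneg 0 T le_rfl hT le_rfl).trans (hlam_le 0 T le_rfl hT le_rfl)
  have hinner {f : ℝ → ℝ → ℝ} {C s : ℝ} (hf : Measurable (Function.uncurry f))
      (hf0 : ∀ s u, 0 ≤ s → s ≤ u → u ≤ T → 0 ≤ f s u)
      (hfC : ∀ s u, 0 ≤ s → s ≤ u → u ≤ T → f s u ≤ C) (hs : 0 ≤ s) (hsT : s ≤ T) :
      IntervalIntegrable (fun u => lam s u * f s u) volume s T := by
    refine intervalIntegrable_of_measurable_of_bound_s14 (B := lamU * C) hsT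
      (hlam.of_uncurry_left.mul hf.of_uncurry_left) fun u hu => ?_
    rw [abs_mul, abs_of_nonneg (hlam_nonneg s u hs hu.1.le hu.2),
      abs_of_nonneg (hf0 s u hs hu.1.le hu.2)]
    exact mul_le_mul (hlam_le s u hs hu.1.le hu.2) (hfC s u hs hu.1.le hu.2)
      (hf0 s u hs hu.1.le hu.2) hU
  rw [← integral_sub
    (intervalIntegrable_drift ht htT hlam hf₁ hlam_nonneg hlam_le hf₁_nonneg hf₁_le hJ)
    (intervalIntegrable_drift ht htT hlam hf₂ hlam_nonneg hlam_le hf₂_nonneg hf₂_le hJ)]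
  rw [← Real.norm_eq_abs]
  refine norm_integral_le_of_norm_le (μ := volume) ht
    (Filter.Eventually.of_forall fun s hs => ?_)
    (Continuous.intervalIntegrable
      (u := fun s => L * (lamU * b s * T) * lamU) (by fun_prop) _ _)
  have hs0 : 0 ≤ s := hs.1.le
  have hsT : s ≤ T := hs.2.trans htT
  have hbs : 0 ≤ b s := (abs_nonneg _).trans (hfb s s hs0 le_rfl hsT)
  have hpos {f : ℝ → ℝ → ℝ} (hf0 : ∀ s u, 0 ≤ s → s ≤ u → u ≤ T → 0 ≤ f s u) :
      0 ≤ ∫ u in s..T, lam s u * f s u :=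
    integral_nonneg hsT fun u hu =>
      mul_nonneg (hlam_nonneg s u hs0 hu.1 hu.2) (hf0 s u hs0 hu.1 hu.2)
  have hJd := hJ.dist_le_mul _ (hpos hf₁_nonneg) _ (hpos hf₂_nonneg)
  rw [Real.dist_eq, Real.dist_eq, ← integral_sub (hinner hf₁ hf₁_nonneg hf₁_le hs0 hsT)
    (hinner hf₂ hf₂_nonneg hf₂_le hs0 hsT)] at hJd
  have hdiff : |∫ u in s..T, (lam s u * f₁ s u - lam s u * f₂ s u)| ≤ lamU * b s * T := by
    have h := norm_integral_le_of_norm_le_const (a := s) (b := T)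
      (f := fun u => lam s u * f₁ s u - lam s u * f₂ s u) (C := lamU * b s) fun u hu => by
        rw [uIoc_of_le hsT] at hu
        rw [Real.norm_eq_abs, ← mul_sub, abs_mul,
          abs_of_nonneg (hlam_nonneg s u hs0 hu.1.le hu.2)]
        exact mul_le_mul (hlam_le s u hs0 hu.1.le hu.2) (hfb s u hs0 hu.1.le hu.2)
          (abs_nonneg _) hU
    rw [abs_of_nonneg (sub_nonneg.2 hsT)] at h
    refine h.trans ?_
    gcongr
    linarith
  rw [← sub_mul, Real.norm_eq_abs, abs_mul, abs_of_nonneg (hlam_nonneg s T hs0 hsT le_rfl)]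
  exact mul_le_mul (hJd.trans (mul_le_mul_of_nonneg_left hdiff L.coe_nonneg))
    (hlam_le s T hs0 hsT le_rfl) (hlam_nonneg s T hs0 hsT le_rfl) (by positivity)

/-- pathwise uniqueness for the HJM fixed-point equation with
linear volatility when `J′` is Lipschitz and monotone increasing on `[0,∞)`:
two bounded nonnegative measurable solutions on the triangle `𝒯` coincide. -/
theorem stmt14 (Tstar : ℝ) (hTstar : 0 < Tstar)
    (lamL lamU : ℝ) (hlamL : 0 < lamL) (hlamLU : lamL ≤ lamU)
    (lam : ℝ → ℝ → ℝ) (hlam_meas : Measurable (Function.uncurry lam))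
    (hlam_bdd : ∀ t T, 0 ≤ t → t ≤ T → T ≤ Tstar → lamL ≤ lam t T ∧ lam t T ≤ lamU)
    (a : ℝ → ℝ → ℝ) (ha_meas : Measurable (Function.uncurry a))
    (ha_pos : ∀ t T, 0 ≤ t → t ≤ T → T ≤ Tstar → 0 < a t T)
    (K : ℝ) (ha_bdd : ∀ t T, 0 ≤ t → t ≤ T → T ≤ Tstar → a t T ≤ K)
    (J' : ℝ → ℝ) (L : NNReal) (hJlip : LipschitzOnWith L J' (Ici 0))
    (hJmono : MonotoneOn J' (Ici 0))
    (f₁ f₂ : ℝ → ℝ → ℝ)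
    (hf₁_meas : Measurable (Function.uncurry f₁)) (hf₂_meas : Measurable (Function.uncurry f₂))
    (hf₁_nonneg : ∀ t T, 0 ≤ t → t ≤ T → T ≤ Tstar → 0 ≤ f₁ t T)
    (hf₂_nonneg : ∀ t T, 0 ≤ t → t ≤ T → T ≤ Tstar → 0 ≤ f₂ t T)
    (C₁ : ℝ) (hf₁_bdd : ∀ t T, 0 ≤ t → t ≤ T → T ≤ Tstar → f₁ t T ≤ C₁)
    (C₂ : ℝ) (hf₂_bdd : ∀ t T, 0 ≤ t → t ≤ T → T ≤ Tstar → f₂ t T ≤ C₂)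
    (hfix₁ : ∀ t T, 0 ≤ t → t ≤ T → T ≤ Tstar →
      f₁ t T = a t T * Real.exp (∫ s in (0 : ℝ)..t,
        J' (∫ u in s..T, lam s u * f₁ s u) * lam s T))
    (hfix₂ : ∀ t T, 0 ≤ t → t ≤ T → T ≤ Tstar →
      f₂ t T = a t T * Real.exp (∫ s in (0 : ℝ)..t,
        J' (∫ u in s..T, lam s u * f₂ s u) * lam s T)) :
    ∀ t T, 0 ≤ t → t ≤ T → T ≤ Tstar → f₁ t T = f₂ t T := by
  have hlam0 : ∀ t T, 0 ≤ t → t ≤ T → T ≤ Tstar → 0 ≤ lam t T := fun t T h₁ h₂ h₃ =>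
    hlamL.le.trans (hlam_bdd t T h₁ h₂ h₃).1
  have hC : 0 ≤ C₁ + C₂ := add_nonneg
    ((hf₁_nonneg 0 0 le_rfl le_rfl hTstar.le).trans (hf₁_bdd 0 0 le_rfl le_rfl hTstar.le))
    ((hf₂_nonneg 0 0 le_rfl le_rfl hTstar.le).trans (hf₂_bdd 0 0 le_rfl le_rfl hTstar.le))
  have hU : 0 ≤ lamU := hlamL.le.trans hlamLU
  obtain ⟨κ, hκ⟩ : ∃ κ : ℝ, κ = (C₁ + C₂) * (L * (lamU * Tstar) * lamU) := ⟨_, rfl⟩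
  have hκ0 : 0 ≤ κ := by rw [hκ]; positivity
  have picard (n : ℕ) : ∀ t T, 0 ≤ t → t ≤ T → T ≤ Tstar →
      |f₁ t T - f₂ t T| ≤ (C₁ + C₂) * ((κ * t) ^ n / n.factorial) := by
    induction n with
    | zero =>
      intro t T h₁ h₂ h₃
      have := hf₁_nonneg t T h₁ h₂ h₃
      have := hf₂_nonneg t T h₁ h₂ h₃
      have := hf₁_bdd t T h₁ h₂ h₃
      have := hf₂_bdd t T h₁ h₂ h₃
      simp only [pow_zero, Nat.factorial_zero, Nat.cast_one, div_one, mul_one]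
      exact abs_le.2 ⟨by linarith, by linarith⟩
    | succ n ih =>
      intro t T h₁ h₂ h₃
      have hdrift := abs_integral_drift_sub_le (C₁ := C₁) (C₂ := C₂) (lamU := lamU)
        (b := fun s => (C₁ + C₂) * ((κ * s) ^ n / n.factorial)) h₁ h₂ hlam_meas hf₁_meas hf₂_meas
        (fun s u a₁ a₂ a₃ => hlam0 s u a₁ a₂ (a₃.trans h₃))
        (fun s u a₁ a₂ a₃ => (hlam_bdd s u a₁ a₂ (a₃.trans h₃)).2)
        (fun s u a₁ a₂ a₃ => hf₁_nonneg s u a₁ a₂ (a₃.trans h₃))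
        (fun s u a₁ a₂ a₃ => hf₁_bdd s u a₁ a₂ (a₃.trans h₃))
        (fun s u a₁ a₂ a₃ => hf₂_nonneg s u a₁ a₂ (a₃.trans h₃))
        (fun s u a₁ a₂ a₃ => hf₂_bdd s u a₁ a₂ (a₃.trans h₃))
        hJlip (by fun_prop) (fun s u a₁ a₂ a₃ => ih s u a₁ a₂ (a₃.trans h₃))
      have hval : ∫ s in (0 : ℝ)..t,
          L * (lamU * ((C₁ + C₂) * ((κ * s) ^ n / n.factorial)) * T) * lamU =
          L * (lamU * (C₁ + C₂) * T) * lamU * κ ^ n * t ^ (n + 1) / (n + 1).factorial := by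
        have h (s : ℝ) : L * (lamU * ((C₁ + C₂) * ((κ * s) ^ n / n.factorial)) * T) * lamU =
            (L * (lamU * (C₁ + C₂) * T) * lamU * κ ^ n / n.factorial) * s ^ n := by
          rw [mul_pow]; ring
        simp_rw [h]
        rw [intervalIntegral.integral_const_mul, integral_pow, Nat.factorial_succ]
        have : (n.factorial : ℝ) ≠ 0 := by positivity
        push_cast
        field_simp
        simp
      rw [hval] at hdrift
      have hexp := abs_exp_sub_exp_le_s14
        (∫ s in (0 : ℝ)..t, J' (∫ u in s..T, lam s u * f₁ s u) * lam s T)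
        (∫ s in (0 : ℝ)..t, J' (∫ u in s..T, lam s u * f₂ s u) * lam s T)
      have ha := (ha_pos t T h₁ h₂ h₃).le
      have e₁ := hfix₁ t T h₁ h₂ h₃
      have e₂ := hfix₂ t T h₁ h₂ h₃
      have b₁ := hf₁_bdd t T h₁ h₂ h₃
      have b₂ := hf₂_bdd t T h₁ h₂ h₃
      set I₁ := ∫ s in (0 : ℝ)..t, J' (∫ u in s..T, lam s u * f₁ s u) * lam s T
      set I₂ := ∫ s in (0 : ℝ)..t, J' (∫ u in s..T, lam s u * f₂ s u) * lam s T
      calc |f₁ t T - f₂ t T| = a t T * |Real.exp I₁ - Real.exp I₂| := by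
            rw [e₁, e₂, ← mul_sub, abs_mul, abs_of_nonneg ha]
        _ ≤ a t T * ((Real.exp I₁ + Real.exp I₂) * |I₁ - I₂|) := by gcongr
        _ = (f₁ t T + f₂ t T) * |I₁ - I₂| := by rw [e₁, e₂]; ring
        _ ≤ (C₁ + C₂) *
            (L * (lamU * (C₁ + C₂) * Tstar) * lamU * κ ^ n * t ^ (n + 1) / (n + 1).factorial) := by
          refine mul_le_mul (add_le_add b₁ b₂) (hdrift.trans ?_) (abs_nonneg _) hC
          gcongr
        _ = (C₁ + C₂) * ((κ * t) ^ (n + 1) / (n + 1).factorial) := by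
          rw [show L * (lamU * (C₁ + C₂) * Tstar) * lamU = κ by rw [hκ]; ring]
          ring
  intro t T h₁ h₂ h₃
  have hlim := (FloorSemiring.tendsto_pow_div_factorial_atTop (κ * t)).const_mul (C₁ + C₂)
  rw [mul_zero] at hlim
  have hle := ge_of_tendsto' hlim fun n => picard n t T h₁ h₂ h₃
  exact sub_eq_zero.1 (abs_eq_zero.1 (le_antisymm hle (abs_nonneg _)))
end
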